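/- arXiv:1507.06900 — 3 statements merged into one kernel-verified Lean document; each statement's English description precedes it below -/
import Mathlib

section
/- Let p, q ∈ ℝ^m be probability distributions such that q has full rank, q ≠ (1/m,…,1/m), and H_α(p) < H_α(q) for all real α ≥ 1 as well as H_∞(p) < H_∞(q). Then there exist a ∈ (0, m·min_i q_i) and N ∈ ℕ such that, setting a_i := a/m and letting q_{AB} be the corresponding bipartite extension of q with parameter n, one has p ⊗ q_B ≻_T q_{AB} for all n ≥ N. -/
open scoped BigOperators

/-- `p` is a probability distribution on the finite type `ι`. -/
def IsProbDist {ι : Type*} [Fintype ι] (p : ι → ℝ) : Prop :=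
  (∀ i, 0 ≤ p i) ∧ ∑ i, p i = 1

/-- `p` is a probability distribution with strictly positive entries. -/
def IsPosProbDist {ι : Type*} [Fintype ι] (p : ι → ℝ) : Prop :=
  (∀ i, 0 < p i) ∧ ∑ i, p i = 1

/-- `p` majorizes `q`: for every `k`, the sum of the `k` largest entries of `p` is at least
the sum of the `k` largest entries of `q`.  For nonnegative vectors this is equivalent to:
for every set `A` of indices of `q` there is a set `B` of indices of `p` with `|B| ≤ |A|`
whose `p`-sum dominates the `q`-sum over `A`. -/
def Majorizes {ι κ : Type*} [Fintype ι] [Fintype κ] (p : ι → ℝ) (q : κ → ℝ) : Prop :=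
  ∀ A : Finset κ, ∃ B : Finset ι, B.card ≤ A.card ∧ ∑ j ∈ A, q j ≤ ∑ i ∈ B, p i

/-- Kronecker (tensor) product of two vectors. -/
def kron {ι κ : Type*} (p : ι → ℝ) (q : κ → ℝ) : ι × κ → ℝ :=
  fun x => p x.1 * q x.2

/-- Shannon entropy (natural logarithm; note `Real.log 0 = 0`, so `0 log 0 = 0`). -/
noncomputable def shannonEntropy {ι : Type*} [Fintype ι] (p : ι → ℝ) : ℝ :=
  -∑ i, p i * Real.log (p i)

open Classical in
/-- The number of nonzero entries of `p`. -/
noncomputable def distRank {ι : Type*} [Fintype ι] (p : ι → ℝ) : ℕ :=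
  (Finset.univ.filter fun i => p i ≠ 0).card

/-- Marginal of a `k`-partite distribution on its `i`-th factor. -/
noncomputable def marginal {k : ℕ} {d : Fin k → ℕ} (r : (∀ i, Fin (d i)) → ℝ) (i : Fin k) :
    Fin (d i) → ℝ :=
  fun b => ∑ y : ∀ j, Fin (d j), if y i = b then r y else 0

open Classical in
/-- Rényi entropy of order `α` (with `H₁` being the Shannon entropy). -/
noncomputable def renyi {ι : Type*} [Fintype ι] (α : ℝ) (p : ι → ℝ) : ℝ :=
  if α = 1 then shannonEntropy p
  else (Real.sign α / (1 - α)) * Real.log (∑ i, p i ^ α)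

/-- Min-entropy `H_∞(p) = -log (max_i p_i)`. -/
noncomputable def renyiInf {ι : Type*} [Fintype ι] (p : ι → ℝ) : ℝ :=
  -Real.log (⨆ i, p i)

/-- Burg entropy `H_Burg(p) = (1/m) ∑ log p_i`. -/
noncomputable def burg {ι : Type*} [Fintype ι] (p : ι → ℝ) : ℝ :=
  (1 / (Fintype.card ι : ℝ)) * ∑ i, Real.log (p i)

open Classical in
/-- Rényi entropy as an extended real: it is `-∞` for `α < 0` when `p` has a zero entry. -/
noncomputable def renyiE {ι : Type*} [Fintype ι] (α : ℝ) (p : ι → ℝ) : EReal :=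
  if α < 0 ∧ ∃ i, p i = 0 then ⊥ else (renyi α p : EReal)

open Classical in
/-- Burg entropy as an extended real: it is `-∞` when `p` has a zero entry. -/
noncomputable def burgE {ι : Type*} [Fintype ι] (p : ι → ℝ) : EReal :=
  if ∃ i, p i = 0 then ⊥ else (burg p : EReal)

/-- `p` trumps `q`: there is a catalyst distribution `r` with `p ⊗ r ≻ q ⊗ r`. -/
def Trumps {ι κ : Type*} [Fintype ι] [Fintype κ] (p : ι → ℝ) (q : κ → ℝ) : Prop :=
  ∃ (n : ℕ) (r : Fin n → ℝ), IsProbDist r ∧ Majorizes (kron p r) (kron q r)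

/-- The bipartite extension `q_{AB}` of `q` with parameters `a i ∈ [0, q i]` and `n`:
the `m × (n+1)` matrix whose first column is `(q i - a i)` and whose remaining `n`
columns all equal `(a i / n)`. -/
noncomputable def qAB {m : ℕ} (q a : Fin m → ℝ) (n : ℕ) : Fin m × Fin (n + 1) → ℝ :=
  fun x => if x.2 = 0 then q x.1 - a x.1 else a x.1 / n

/-- The `B`-marginal `(1 - a, a/n, …, a/n)` of `qAB`, where `a = ∑ i, a i`. -/
noncomputable def qBext {m : ℕ} (a : Fin m → ℝ) (n : ℕ) : Fin (n + 1) → ℝ :=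
  fun j => if j = 0 then 1 - ∑ i, a i else (∑ i, a i) / n

/-- Symmetry of an entropy-like functional on positive distributions. -/
def SymmetricS (S : ∀ n : ℕ, (Fin n → ℝ) → ℝ) : Prop :=
  ∀ (n : ℕ) (p : Fin n → ℝ), IsPosProbDist p →
    ∀ σ : Equiv.Perm (Fin n), S n (p ∘ σ) = S n p

/-- Additivity: `S(p ⊗ q) = S(p) + S(q)`. -/
def AdditiveS (S : ∀ n : ℕ, (Fin n → ℝ) → ℝ) : Prop :=
  ∀ (m n : ℕ) (p : Fin m → ℝ) (q : Fin n → ℝ), IsPosProbDist p → IsPosProbDist q →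
    S (m * n) (fun x => kron p q (finProdFinEquiv.symm x)) = S m p + S n q

/-- Subadditivity: `S(p_{AB}) ≤ S(p_A ⊗ p_B)` for bipartite distributions. -/
def SubadditiveS (S : ∀ n : ℕ, (Fin n → ℝ) → ℝ) : Prop :=
  ∀ (m n : ℕ) (P : Fin m × Fin n → ℝ), IsPosProbDist P →
    S (m * n) (fun x => P (finProdFinEquiv.symm x)) ≤
      S (m * n) (fun x =>
        kron (fun i => ∑ j, P (i, j)) (fun j => ∑ i, P (i, j)) (finProdFinEquiv.symm x))

/-- Continuity of `S` on each simplex of positive distributions. -/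
def ContinuousS (S : ∀ n : ℕ, (Fin n → ℝ) → ℝ) : Prop :=
  ∀ n : ℕ, ContinuousOn (S n) {p : Fin n → ℝ | IsPosProbDist p}

section Part1
open scoped BigOperators

def Hinge {ι κ : Type*} [Fintype ι] [Fintype κ] (P : ι → ℝ) (Q : κ → ℝ) : Prop :=
  ∀ t : ℝ, 0 ≤ t → ∑ j, max (Q j - t) 0 ≤ ∑ i, max (P i - t) 0

theorem Hinge.trans' {ι κ μ : Type*} [Fintype ι] [Fintype κ] [Fintype μ]
    {P : ι → ℝ} {Q : κ → ℝ} {R : μ → ℝ} (h1 : Hinge P Q) (h2 : Hinge Q R) : Hinge P R :=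
  fun t ht => (h2 t ht).trans (h1 t ht)

theorem Hinge.kron' {ι κ μ : Type*} [Fintype ι] [Fintype κ] [Fintype μ]
    {P : ι → ℝ} {Q : κ → ℝ} (h : Hinge P Q) (r : μ → ℝ) (hr : ∀ k, 0 ≤ r k) :
    Hinge (kron P r) (kron Q r) := by
  intro t ht
  rw [Fintype.sum_prod_type_right, Fintype.sum_prod_type_right]
  refine Finset.sum_le_sum fun k _ => ?_
  simp only [kron]
  rcases (hr k).eq_or_lt with h0 | h0
  · simp [← h0, ht]
  · have key : ∀ u : ℝ, max (u * r k - t) 0 = r k * max (u - t / r k) 0 := by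
      intro u
      rw [mul_max_of_nonneg _ _ h0.le]
      congr 1
      · field_simp
      · simp
    simp only [key, ← Finset.mul_sum]
    exact mul_le_mul_of_nonneg_left (h _ (by positivity)) h0.le

theorem Hinge.majorizes {ι κ : Type*} [Fintype ι] [Fintype κ]
    {P : ι → ℝ} {Q : κ → ℝ} (h : Hinge P Q) (hP : ∀ i, 0 ≤ P i) (hQ : ∀ i, 0 ≤ Q i) :
    Majorizes P Q := by
  classical
  intro A
  rcases Finset.eq_empty_or_nonempty A with rfl | hA
  · exact ⟨∅, by simp, by simp⟩
  rcases le_or_gt (Fintype.card ι) A.card with hc | hc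
  · refine ⟨Finset.univ, hc, ?_⟩
    have := h 0 le_rfl
    simp only [sub_zero, max_eq_left (hP _), max_eq_left (hQ _)] at this
    exact (Finset.sum_le_sum_of_subset_of_nonneg (Finset.subset_univ A)
      (fun i _ _ => hQ i)).trans this
  · obtain ⟨B, hB, hmax⟩ := Finset.exists_max_image
      (Finset.powersetCard A.card (Finset.univ : Finset ι)) (fun B => ∑ i ∈ B, P i)
      (by rw [Finset.powersetCard_nonempty]; simpa using hc.le)
    rw [Finset.mem_powersetCard] at hB
    have hBn : B.Nonempty := by
      rw [← Finset.card_pos, hB.2]; exact hA.card_pos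
    obtain ⟨i0, hi0, hmin⟩ := Finset.exists_min_image B P hBn
    refine ⟨B, hB.2.le, ?_⟩
    have hout : ∀ j, j ∉ B → P j ≤ P i0 := by
      intro j hj
      have hj' : j ∉ B.erase i0 := fun hh => hj (Finset.mem_of_mem_erase hh)
      have := hmax (insert j (B.erase i0)) (by
        rw [Finset.mem_powersetCard]
        refine ⟨Finset.subset_univ _, ?_⟩
        rw [Finset.card_insert_of_notMem hj', Finset.card_erase_of_mem hi0, hB.2]
        have := hA.card_pos
        omega)
      rw [Finset.sum_insert hj'] at this
      have h2 := Finset.add_sum_erase B P hi0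
      linarith
    have e1 : ∑ i, max (P i - P i0) 0 = ∑ i ∈ B, (P i - P i0) := by
      rw [← Finset.sum_subset (Finset.subset_univ B)]
      · exact Finset.sum_congr rfl fun i hi => max_eq_left (sub_nonneg.2 (hmin i hi))
      · intro j _ hj
        exact max_eq_right (sub_nonpos.2 (hout j hj))
    have e2 := h (P i0) (hP i0)
    have e3 : ∑ j ∈ A, (Q j - P i0) ≤ ∑ j, max (Q j - P i0) 0 :=
      (Finset.sum_le_sum fun j _ => le_max_left (Q j - P i0) 0).trans
        (Finset.sum_le_sum_of_subset_of_nonneg (Finset.subset_univ A)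
          (fun i _ _ => le_max_right _ _))
    rw [e1] at e2
    have e4 := e3.trans e2
    simp only [Finset.sum_sub_distrib, Finset.sum_const, hB.2] at e4
    linarith

theorem trumps_of_hinge {ι κ μ : Type*} [Fintype ι] [Fintype κ] [Fintype μ]
    {P : ι → ℝ} {Q : κ → ℝ} (hP : ∀ i, 0 ≤ P i) (hQ : ∀ i, 0 ≤ Q i)
    (r : μ → ℝ) (hr : IsProbDist r) (h : Hinge (kron P r) (kron Q r)) : Trumps P Q := by
  let e := (Fintype.equivFin μ).symm
  refine ⟨Fintype.card μ, r ∘ e, ⟨fun i => hr.1 _, ?_⟩, ?_⟩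
  · rw [← hr.2]; exact Equiv.sum_comp e r
  · apply Hinge.majorizes
    · intro t ht
      have := h t ht
      have k1 : ∑ x, max (kron P (r ∘ e) x - t) 0 = ∑ x, max (kron P r x - t) 0 := by
        rw [Fintype.sum_prod_type, Fintype.sum_prod_type]
        refine Finset.sum_congr rfl fun i _ => ?_
        exact Equiv.sum_comp e (fun k => max (P i * r k - t) 0)
      have k2 : ∑ x, max (kron Q (r ∘ e) x - t) 0 = ∑ x, max (kron Q r x - t) 0 := by
        rw [Fintype.sum_prod_type, Fintype.sum_prod_type]
        refine Finset.sum_congr rfl fun i _ => ?_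
        exact Equiv.sum_comp e (fun k => max (Q i * r k - t) 0)
      rw [k1, k2]; exact this
    · intro x; exact mul_nonneg (hP _) (hr.1 _)
    · intro x; exact mul_nonneg (hQ _) (hr.1 _)

/-- A vector close to uniform is majorized by a non-uniform one. -/
theorem hinge_near_unif {ι : Type*} [Fintype ι] (P w : ι → ℝ) (η : ℝ)
    (hP1 : ∑ i, P i = 1) (hw1 : ∑ i, w i = 1)
    (hw : ∀ i, |w i - 1 / Fintype.card ι| ≤ η) (i0 : ι)
    (h0 : (2 * Fintype.card ι + 1) * η ≤ P i0 - 1 / Fintype.card ι) : Hinge P w := by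
  intro t ht
  have hnn : ∀ i ∈ (Finset.univ : Finset ι), 0 ≤ max (P i - t) 0 := fun i _ => le_max_right _ _
  have hn : (0 : ℝ) ≤ Fintype.card ι := by positivity
  have hη : 0 ≤ η := (abs_nonneg _).trans (hw i0)
  rcases le_or_gt t (1 / Fintype.card ι - η) with h1 | h1
  · have : ∑ i, max (w i - t) 0 = ∑ i, (w i - t) := by
      refine Finset.sum_congr rfl fun i _ => max_eq_left ?_
      have := (abs_le.1 (hw i)).1
      linarith
    rw [this]
    calc ∑ i, (w i - t) = ∑ i, (P i - t) := by simp [Finset.sum_sub_distrib, hP1, hw1]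
      _ ≤ _ := Finset.sum_le_sum fun i _ => le_max_left _ _
  · rcases le_or_gt (1 / Fintype.card ι + η) t with h2 | h2
    · have : ∑ i, max (w i - t) 0 = 0 := by
        refine Finset.sum_eq_zero fun i _ => max_eq_right ?_
        have := (abs_le.1 (hw i)).2
        linarith
      rw [this]
      exact Finset.sum_nonneg hnn
    · calc ∑ i, max (w i - t) 0 ≤ ∑ i : ι, 2 * η := by
            refine Finset.sum_le_sum fun i _ => max_le ?_ (by linarith)
            have := (abs_le.1 (hw i)).2
            linarith
        _ = Fintype.card ι * (2 * η) := by simp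
        _ ≤ P i0 - t := by nlinarith
        _ ≤ max (P i0 - t) 0 := le_max_left _ _
        _ ≤ _ := Finset.single_le_sum hnn (Finset.mem_univ i0)

theorem hinge_mix {ι κ : Type*} [Fintype ι] [Fintype κ] (R : κ → ℝ) (P Q : ι → ℝ) (ε : ℝ) (h0 : 0 ≤ ε)
    (h1 : ε ≤ 1) (hP : Hinge R P) (hQ : Hinge R Q) :
    Hinge R (fun i => (1 - ε) * P i + ε * Q i) := by
  intro t ht
  have a := hP t ht
  have b := hQ t ht
  calc ∑ i, max ((1 - ε) * P i + ε * Q i - t) 0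
      ≤ ∑ i, ((1 - ε) * max (P i - t) 0 + ε * max (Q i - t) 0) := by
        refine Finset.sum_le_sum fun i _ => max_le ?_ ?_
        · have := mul_le_mul_of_nonneg_left (le_max_left (P i - t) 0) (sub_nonneg.2 h1)
          have := mul_le_mul_of_nonneg_left (le_max_left (Q i - t) 0) h0
          nlinarith
        · have := mul_nonneg (sub_nonneg.2 h1) (le_max_right (P i - t) 0)
          have := mul_nonneg h0 (le_max_right (Q i - t) 0)
          linarith
    _ = (1 - ε) * ∑ i, max (P i - t) 0 + ε * ∑ i, max (Q i - t) 0 := by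
        rw [Finset.sum_add_distrib, Finset.mul_sum, Finset.mul_sum]
    _ ≤ _ := by
        have := mul_le_mul_of_nonneg_left a (sub_nonneg.2 h1)
        have := mul_le_mul_of_nonneg_left b h0
        linarith

end Part1

section Part2
open Polynomial

def NN (g : ℝ[X]) : Prop := ∀ k, 0 ≤ g.coeff k

theorem NN.mul' {f g : ℝ[X]} (hf : NN f) (hg : NN g) : NN (f * g) := by
  intro k
  rw [coeff_mul]
  exact Finset.sum_nonneg fun x _ => mul_nonneg (hf _) (hg _)

def Good (g : ℝ[X]) : Prop := ∃ N : ℕ, NN ((1 + X) ^ N * g)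

theorem Good.mul' {f g : ℝ[X]} (hf : Good f) (hg : Good g) : Good (f * g) := by
  obtain ⟨N, h1⟩ := hf
  obtain ⟨M, h2⟩ := hg
  refine ⟨N + M, ?_⟩
  have : (1 + X : ℝ[X]) ^ (N + M) * (f * g) = ((1 + X) ^ N * f) * ((1 + X) ^ M * g) := by ring
  rw [this]; exact h1.mul' h2

theorem NN.good {f : ℝ[X]} (h : NN f) : Good f := ⟨0, by simpa using h⟩

theorem NN.eval_nonneg {f : ℝ[X]} (h : NN f) {x : ℝ} (hx : 0 ≤ x) : 0 ≤ f.eval x := by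
  rw [eval_eq_sum, Polynomial.sum]
  exact Finset.sum_nonneg fun k _ => mul_nonneg (h k) (pow_nonneg hx _)

theorem choose_id1 (N k : ℕ) (hk : 2 ≤ k) (hkN : k ≤ N + 2) :
    ((N + 2 : ℝ) * (N + 1)) * (N.choose (k - 2)) = (k * (k - 1 : ℝ)) * ((N + 2).choose k) := by
  obtain ⟨j, rfl⟩ := Nat.exists_eq_add_of_le' hk
  have h1 := Nat.add_one_mul_choose_eq (N + 1) (j + 1)
  have h2 := Nat.add_one_mul_choose_eq N j
  have h1' : ((N : ℝ) + 1 + 1) * ((N+1).choose (j+1) : ℝ) = ((N+1+1).choose (j+1+1)) * (j + 1 + 1) := by exact_mod_cast h1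
  have h2' : ((N : ℝ) + 1) * (N.choose j : ℝ) = ((N+1).choose (j+1)) * (j + 1) := by exact_mod_cast h2
  simp only [Nat.add_sub_cancel]
  push_cast
  have : (N + 2 : ℝ) * (N + 1) * (N.choose j) = (N + 2) * ((N + 1) * N.choose j) := by ring
  rw [this, h2']
  have : (N + 2 : ℝ) * (((N+1).choose (j+1)) * (j + 1)) = ((N + 1 + 1) * ((N+1).choose (j+1))) * (j+1) := by ring
  rw [this, h1']
  ring

/-- coefficients of `(1+X)^N (X^2 + bX + c)`, up to a positive factor -/
theorem coeff_quad (N k : ℕ) (b c : ℝ) (hk : k ≤ N + 2) :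
    ((N + 2 : ℝ) * (N + 1)) * ((1 + X : ℝ[X]) ^ N * (X ^ 2 + C b * X + C c)).coeff k
      = ((N + 2).choose k) * (k * (k - 1 : ℝ) + b * (k * (N + 2 - k)) +
        c * ((N + 2 - k) * (N + 1 - k))) := by
  have e : ((1 + X : ℝ[X]) ^ N * (X ^ 2 + C b * X + C c))
      = (1 + X : ℝ[X]) ^ N * X ^ 2 + C b * ((1 + X : ℝ[X]) ^ N * X ^ 1) + C c * (1 + X) ^ N := by
    ring
  rw [e]
  simp only [coeff_add, coeff_C_mul, coeff_mul_X_pow', coeff_one_add_X_pow]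
  have a1 : ((N + 2 : ℝ) * (N + 1)) * (if 2 ≤ k then ((N.choose (k - 2) : ℕ) : ℝ) else 0)
      = (k * (k - 1 : ℝ)) * ((N + 2).choose k) := by
    split_ifs with h
    · exact choose_id1 N k h hk
    · have : k = 0 ∨ k = 1 := by omega
      rcases this with rfl | rfl <;> simp
  have a2 : ((N + 2 : ℝ) * (N + 1)) * (if 1 ≤ k then ((N.choose (k - 1) : ℕ) : ℝ) else 0)
      = (k * (N + 2 - k)) * ((N + 2).choose k) := by
    split_ifs with h
    · obtain ⟨j, rfl⟩ := Nat.exists_eq_add_of_le' h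
      have h1 : ((N : ℝ) + 1 + 1) * ((N+1).choose j : ℝ) = ((N+1+1).choose (j+1)) * (j + 1) := by
        exact_mod_cast Nat.add_one_mul_choose_eq (N + 1) j
      have h2 : (N.choose j : ℝ) * (N + 1) = ((N+1).choose j) * (N + 1 - j) := by
        have := Nat.choose_mul_succ_eq N j
        have h3 : ((N + 1 - j : ℕ) : ℝ) = N + 1 - j := by
          rw [Nat.cast_sub (by omega)]; push_cast; ring
        rw [← h3]; exact_mod_cast this
      simp only [Nat.add_sub_cancel]
      push_cast
      have : (N + 2 : ℝ) * (N + 1) * (N.choose j) = (N + 2) * (N.choose j * (N + 1)) := by ring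
      rw [this, h2]
      have : (N + 2 : ℝ) * (((N+1).choose j) * (N + 1 - j)) = ((N + 1 + 1) * ((N+1).choose j)) * (N + 1 - j) := by ring
      rw [this, h1]
      ring
    · have : k = 0 := by omega
      subst this; simp
  have a3 : ((N + 2 : ℝ) * (N + 1)) * (N.choose k) =
      ((N + 2 - k) * (N + 1 - k)) * ((N + 2).choose k) := by
    have h2 : ((N+1).choose k : ℝ) * (N + 1 + 1) = ((N+1+1).choose k) * (N + 1 + 1 - k) := by
      have := Nat.choose_mul_succ_eq (N + 1) k
      have h3 : ((N + 1 + 1 - k : ℕ) : ℝ) = N + 1 + 1 - k := by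
        rw [Nat.cast_sub (by omega)]; push_cast; ring
      rw [← h3]; exact_mod_cast this
    rcases Nat.lt_or_ge (N + 1) k with h | h
    · have : k = N + 2 := by omega
      subst this
      rw [Nat.choose_eq_zero_of_lt (by omega)]; push_cast; ring
    · have h1 : (N.choose k : ℝ) * (N + 1) = ((N+1).choose k) * (N + 1 - k) := by
        have := Nat.choose_mul_succ_eq N k
        have h3 : ((N + 1 - k : ℕ) : ℝ) = N + 1 - k := by
          rw [Nat.cast_sub (by omega)]; push_cast; ring
        rw [← h3]; exact_mod_cast this
      have : (N + 2 : ℝ) * (N + 1) * (N.choose k) = (N + 2) * (N.choose k * (N + 1)) := by ring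
      rw [this, h1]
      have : (N + 2 : ℝ) * (((N+1).choose k) * (N + 1 - k)) = (((N+1).choose k) * (N + 1 + 1)) * (N + 1 - k) := by ring
      rw [this, h2]
      ring
  linear_combination a1 + b * a2 + c * a3

theorem good_quad (b c : ℝ) (h : b ^ 2 < 4 * c) : Good (X ^ 2 + C b * X + C c) := by
  have hc : 0 < c := by nlinarith [sq_nonneg b]
  -- form k² + b k l + c l² ≥ δ (k + l)²
  obtain ⟨δ, hδ, hform⟩ : ∃ δ : ℝ, 0 < δ ∧ ∀ k l : ℝ, 0 ≤ k → 0 ≤ l →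
      δ * (k + l) ^ 2 ≤ k ^ 2 + b * (k * l) + c * l ^ 2 := by
    set d := (4 * c - b ^ 2) with hd
    have hdpos : 0 < d := by linarith
    refine ⟨d / (8 * (c + 1)), by positivity, fun k l hk hl => ?_⟩
    have h1 : d * k ^ 2 ≤ 4 * c * (k ^ 2 + b * (k * l) + c * l ^ 2) := by
      nlinarith [sq_nonneg (b * k + 2 * c * l)]
    have h2 : d * l ^ 2 ≤ 4 * (k ^ 2 + b * (k * l) + c * l ^ 2) := by
      nlinarith [sq_nonneg (2 * k + b * l)]
    rw [div_mul_eq_mul_div, div_le_iff₀ (by positivity)]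
    nlinarith [sq_nonneg (k - l)]
  obtain ⟨N, hN⟩ := exists_nat_gt ((1 + c) / δ)
  refine ⟨N, fun k => ?_⟩
  rcases Nat.lt_or_ge (N + 2) k with hk | hk
  · rw [coeff_eq_zero_of_natDegree_lt]
    refine lt_of_le_of_lt ?_ hk
    compute_degree
  · have key := coeff_quad N k b c hk
    have hpos : (0 : ℝ) < (N + 2 : ℝ) * (N + 1) := by positivity
    refine nonneg_of_mul_nonneg_right (a := (N + 2 : ℝ) * (N + 1)) ?_ hpos
    rw [key]
    refine mul_nonneg (by positivity) ?_
    have hk' : (k : ℝ) ≤ N + 2 := by exact_mod_cast hk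
    have hk0 : (0 : ℝ) ≤ k := by positivity
    have := hform k (N + 2 - k) hk0 (by linarith)
    have hN' : 1 + c < N * δ := by rwa [div_lt_iff₀ hδ] at hN
    have e : (k : ℝ) + (N + 2 - k) = N + 2 := by ring
    rw [e] at this
    have hN0 : (0:ℝ) ≤ N := by positivity
    have h3 : (1 + c) * (N + 2) ≤ δ * (N + 2) ^ 2 := by nlinarith
    nlinarith

theorem good_irred (g : ℝ[X]) (hg : Irreducible g) (hr : ∀ x, 0 < x → g.eval x ≠ 0) :
    Good g ∨ Good (-g) := by
  have hd := hg.degree_le_two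
  have hnd : g.natDegree ≤ 2 := natDegree_le_of_degree_le hd
  have hform := g.as_sum_range_C_mul_X_pow' (n := 3) (by omega)
  simp only [Finset.sum_range_succ, Finset.sum_range_zero, zero_add, pow_zero, mul_one, pow_one] at hform
  set a := g.coeff 2
  set b := g.coeff 1
  set c := g.coeff 0
  have hev : ∀ x, g.eval x = c + b * x + a * x ^ 2 := by
    intro x; conv_lhs => rw [hform]
    simp
  by_cases ha : a = 0
  · have hcf : ∀ k, g.coeff k = if k = 0 then c else if k = 1 then b else 0 := by
      intro k
      rcases k with _ | _ | _ | k
      · rfl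
      · rfl
      · simpa using ha
      · simp; exact coeff_eq_zero_of_natDegree_lt (by omega)
    have hcb : 0 ≤ c * b := by
      by_contra hneg
      push Not at hneg
      have hb : b ≠ 0 := by rintro h; simp [h] at hneg
      refine hr (-c / b) ?_ ?_
      · have : -c / b = -(c * b) / b ^ 2 := by field_simp
        rw [this]; have : 0 < b ^ 2 := by positivity
        apply div_pos <;> linarith
      · rw [hev, ha]; field_simp; ring
    rcases le_total 0 c with h1 | h1 <;> rcases le_total 0 b with h2 | h2
    · left; apply NN.good; intro k; rw [hcf]; split_ifs <;> simp [*]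
    · rcases h1.eq_or_lt with h3 | h3
      · right; apply NN.good; intro k; rw [coeff_neg, hcf]; split_ifs <;> simp [*]; linarith
      · have : b = 0 := by nlinarith
        left; apply NN.good; intro k; rw [hcf]; split_ifs <;> simp [*]
    · rcases h1.eq_or_lt with h3 | h3
      · left; apply NN.good; intro k; rw [hcf]; split_ifs <;> simp [*]
      · have : b = 0 := by nlinarith
        right; apply NN.good; intro k; rw [coeff_neg, hcf]; split_ifs <;> simp [*]
    · right; apply NN.good; intro k; rw [coeff_neg, hcf]; split_ifs <;> simp [*]
  · have hdeg : g.natDegree = 2 := le_antisymm hnd (le_natDegree_of_ne_zero ha)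
    have hnr : ∀ x, g.eval x ≠ 0 := by
      intro x hx
      have h1 := degree_eq_one_of_irreducible_of_root hg hx
      have h2 : g.natDegree = 1 := natDegree_eq_of_degree_eq_some (by simpa using h1)
      omega
    have hdisc : b ^ 2 < 4 * a * c := by
      by_contra hneg
      push Not at hneg
      have hs := Real.sq_sqrt (sub_nonneg.2 hneg)
      refine hnr ((-b + Real.sqrt (b ^ 2 - 4 * a * c)) / (2 * a)) ?_
      generalize Real.sqrt (b ^ 2 - 4 * a * c) = z at hs
      rw [hev]; field_simp
      linear_combination hs
    have hgq : Good (X ^ 2 + C (b / a) * X + C (c / a)) := by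
      apply good_quad
      have : 0 < a ^ 2 := by positivity
      rw [div_pow, div_lt_iff₀ this]
      have : 4 * (c / a) * a ^ 2 = 4 * a * c := by field_simp
      linarith
    have hfac : g = C a * (X ^ 2 + C (b / a) * X + C (c / a)) := by
      conv_lhs => rw [hform]
      have e1 : C a * C (b / a) = C b := by rw [← C_mul]; congr 1; field_simp
      have e2 : C a * C (c / a) = C c := by rw [← C_mul]; congr 1; field_simp
      rw [mul_add, mul_add, ← mul_assoc, e1, e2]; ring
    have hC : ∀ r : ℝ, 0 ≤ r → Good (C r) := fun r hr => NN.good fun k => by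
      rw [coeff_C]; split_ifs <;> simp [*]
    rcases le_total 0 a with h | h
    · left; rw [hfac]; exact (hC a h).mul' hgq
    · right; rw [hfac, ← neg_mul, ← C_neg]; exact (hC (-a) (by linarith)).mul' hgq

theorem good_or (g : ℝ[X]) (hg : g ≠ 0) (hr : ∀ x, 0 < x → g.eval x ≠ 0) :
    Good g ∨ Good (-g) := by
  induction g using WfDvdMonoid.induction_on_irreducible with
  | zero => exact absurd rfl hg
  | unit u hu =>
    obtain ⟨r, hr, rfl⟩ := Polynomial.isUnit_iff.1 hu
    rcases le_total 0 r with h | h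
    · left; exact NN.good fun k => by rw [coeff_C]; split_ifs <;> simp [*]
    · right; exact NN.good fun k => by rw [coeff_neg, coeff_C]; split_ifs <;> simp [*]
  | mul a i ha hi ih =>
    have h1 := good_irred i hi (fun x hx h => hr x hx (by simp [h]))
    have h2 := ih ha (fun x hx h => hr x hx (by simp [h]))
    rcases h1 with h1 | h1 <;> rcases h2 with h2 | h2
    · left; exact h1.mul' h2
    · right; rw [← mul_neg]; exact h1.mul' h2
    · right; rw [← neg_mul]; exact h1.mul' h2
    · left; rw [← neg_mul_neg]; exact h1.mul' h2

theorem polya (g : ℝ[X]) (hr : ∀ x, 0 < x → 0 < g.eval x) : Good g := by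
  rcases good_or g (by rintro rfl; simpa using hr 1 one_pos) (fun x hx => (hr x hx).ne') with h | ⟨N, h⟩
  · exact h
  · exfalso
    have := h.eval_nonneg (x := 1) zero_le_one
    have h1 := hr 1 one_pos
    simp at this
    have h2 : (0:ℝ) < (1+1) ^ N := by positivity
    nlinarith

end Part2

section Part3
open scoped Topology
open Filter

noncomputable def kk (u α : ℝ) : ℝ :=
  ∫ s in (0:ℝ)..1, (u - 1) ^ 2 * (1 - s) * (1 + s * (u - 1)) ^ (α - 2)

theorem base_pos {u s : ℝ} (hu : 0 < u) (h0 : 0 ≤ s) (h1 : s ≤ 1) : 0 < 1 + s * (u - 1) := by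
  rcases h0.eq_or_lt with h | h
  · simp [← h]
  · nlinarith [mul_pos h hu]

theorem kk_cont_integrand {u : ℝ} (hu : 0 < u) (α : ℝ) :
    ContinuousOn (fun s : ℝ => (u - 1) ^ 2 * (1 - s) * (1 + s * (u - 1)) ^ (α - 2))
      (Set.uIcc 0 1) := by
  rw [Set.uIcc_of_le zero_le_one]
  refine ContinuousOn.mul (by fun_prop) (ContinuousOn.rpow (by fun_prop) (by fun_prop) ?_)
  intro s hs; left; exact (base_pos hu hs.1 hs.2).ne'

theorem kk_formula {u : ℝ} (hu : 0 < u) {α : ℝ} (h0 : α ≠ 0) (h1 : α ≠ 1) :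
    α * (α - 1) * kk u α = u ^ α - 1 - α * (u - 1) := by
  have h1' : α - 1 ≠ 0 := sub_ne_zero.2 h1
  have key : kk u α = (u * (1 + 1 * (u - 1)) ^ (α - 1) / (α - 1) - (1 + 1 * (u - 1)) ^ α / α) -
      (u * (1 + 0 * (u - 1)) ^ (α - 1) / (α - 1) - (1 + 0 * (u - 1)) ^ α / α) := by
    unfold kk
    rw [intervalIntegral.integral_eq_sub_of_hasDerivAt
      (f := fun s => u * (1 + s * (u - 1)) ^ (α - 1) / (α - 1) - (1 + s * (u - 1)) ^ α / α)]
    · intro s hs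
      rw [Set.uIcc_of_le zero_le_one] at hs
      have hb := base_pos hu hs.1 hs.2
      have hd : HasDerivAt (fun s : ℝ => 1 + s * (u - 1)) (u - 1) s := by
        simpa using ((hasDerivAt_id s).mul_const (u - 1)).const_add 1
      have d1 := ((hd.rpow_const (p := α - 1) (Or.inl hb.ne')).const_mul u).div_const (α - 1)
      have d2 := (hd.rpow_const (p := α) (Or.inl hb.ne')).div_const α
      refine HasDerivAt.congr_deriv (d1.sub d2) ?_
      have e1 : (1 + s * (u - 1)) ^ (α - 1) = (1 + s * (u - 1)) ^ (α - 2) * (1 + s * (u - 1)) := by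
        rw [← Real.rpow_add_one hb.ne']; congr 1; ring
      rw [e1, show α - 1 - 1 = α - 2 by ring]
      field_simp
      ring
    · exact (kk_cont_integrand hu α).intervalIntegrable
  rw [key]
  have e1 : u ^ α = u ^ (α - 1) * u := by
    rw [← Real.rpow_add_one hu.ne']; congr 1; ring
  simp only [one_mul, zero_mul, add_zero, Real.one_rpow, add_sub_cancel]
  rw [e1]
  field_simp
  ring

theorem kk_zero {u : ℝ} (hu : 0 < u) : kk u 0 = u - 1 - Real.log u := by
  unfold kk
  rw [intervalIntegral.integral_eq_sub_of_hasDerivAt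
      (f := fun s => -(u * (1 + s * (u - 1))⁻¹) - Real.log (1 + s * (u - 1)))]
  · simp [hu.ne']; ring
  · intro s hs
    rw [Set.uIcc_of_le zero_le_one] at hs
    have hb := base_pos hu hs.1 hs.2
    have hd : HasDerivAt (fun s : ℝ => 1 + s * (u - 1)) (u - 1) s := by
      simpa using ((hasDerivAt_id s).mul_const (u - 1)).const_add 1
    refine HasDerivAt.congr_deriv (((hd.inv hb.ne').const_mul u).neg.sub (hd.log hb.ne')) ?_
    rw [show (0:ℝ) - 2 = -(2:ℕ) by norm_num, Real.rpow_neg hb.le, Real.rpow_natCast]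
    field_simp
    ring
  · exact (kk_cont_integrand hu 0).intervalIntegrable

theorem kk_one {u : ℝ} (hu : 0 < u) : kk u 1 = u * Real.log u - (u - 1) := by
  unfold kk
  rw [intervalIntegral.integral_eq_sub_of_hasDerivAt
      (f := fun s => u * Real.log (1 + s * (u - 1)) - (1 + s * (u - 1)))]
  · simp; ring
  · intro s hs
    rw [Set.uIcc_of_le zero_le_one] at hs
    have hb := base_pos hu hs.1 hs.2
    have hd : HasDerivAt (fun s : ℝ => 1 + s * (u - 1)) (u - 1) s := by
      simpa using ((hasDerivAt_id s).mul_const (u - 1)).const_add 1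
    refine HasDerivAt.congr_deriv (((hd.log hb.ne').const_mul u).sub hd) ?_
    rw [show (1:ℝ) - 2 = -1 by norm_num, Real.rpow_neg_one]
    have hb' := hb.ne'
    rw [← div_eq_mul_inv, eq_div_iff hb', sub_mul, mul_assoc, div_mul_cancel₀ _ hb']
    ring
  · exact (kk_cont_integrand hu 1).intervalIntegrable

theorem kk_nonneg {u : ℝ} (hu : 0 < u) (α : ℝ) : 0 ≤ kk u α := by
  unfold kk
  refine intervalIntegral.integral_nonneg zero_le_one fun s hs => ?_
  have := base_pos hu hs.1 hs.2
  have := sub_nonneg.2 hs.2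
  positivity

theorem kk_pos {u : ℝ} (hu : 0 < u) (h1 : u ≠ 1) (α : ℝ) : 0 < kk u α := by
  unfold kk
  refine intervalIntegral.intervalIntegral_pos_of_pos_on
    (kk_cont_integrand hu α).intervalIntegrable (fun s hs => ?_) zero_lt_one
  have := base_pos hu hs.1.le hs.2.le
  have := sub_pos.2 hs.2
  have := sub_ne_zero.2 h1
  positivity

theorem kk_exp_continuous : Continuous (fun z : ℝ × ℝ => kk (Real.exp z.1) z.2) := by
  have key : Continuous (fun z : ℝ × ℝ => ∫ s in (0:ℝ)..1, (Real.exp z.1 - 1) ^ 2 * (1 - s) *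
      (1 + (max 0 (min s 1)) * (Real.exp z.1 - 1)) ^ (z.2 - 2)) := by
    apply intervalIntegral.continuous_parametric_intervalIntegral_of_continuous'
    refine Continuous.mul (by fun_prop) (Continuous.rpow (by fun_prop) (by fun_prop) ?_)
    intro x; left
    exact (base_pos (Real.exp_pos _) (le_max_left _ _) (max_le zero_le_one (min_le_right _ _))).ne'
  convert key using 2 with z
  unfold kk
  refine intervalIntegral.integral_congr fun s hs => ?_
  rw [Set.uIcc_of_le zero_le_one] at hs
  rw [min_eq_left hs.2, max_eq_right hs.1]

theorem kk_cont_alpha {u : ℝ} (hu : 0 < u) : Continuous (fun α => kk u α) := by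
  have := kk_exp_continuous.comp (Continuous.prodMk_right (Real.log u))
  simpa [Function.comp_def, Real.exp_log hu] using this

/-- scaling -/
theorem kk_scale {ι : Type*} [Fintype ι] (x : ι → ℝ) (hx : ∀ i, 0 < x i)
    (hs : ∑ i, (x i - 1) = 0) {c : ℝ} (hc : 0 < c) (α : ℝ) :
    ∑ i, (kk (c * x i) α - kk c α) = c ^ α * ∑ i, kk (x i) α := by
  have key : ∃ d, ∀ v, 0 < v → kk (c * v) α - kk c α = c ^ α * kk v α + d * (v - 1) := by
    by_cases h0 : α = 0
    · refine ⟨c - 1, fun v hv => ?_⟩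
      subst h0
      rw [kk_zero hc, kk_zero hv, kk_zero (mul_pos hc hv), Real.log_mul hc.ne' hv.ne', Real.rpow_zero]
      ring
    by_cases h1 : α = 1
    · refine ⟨c * Real.log c, fun v hv => ?_⟩
      subst h1
      rw [kk_one hc, kk_one hv, kk_one (mul_pos hc hv), Real.log_mul hc.ne' hv.ne', Real.rpow_one]
      ring
    have h1' : α - 1 ≠ 0 := sub_ne_zero.2 h1
    refine ⟨(c ^ α - c) / (α - 1), fun v hv => ?_⟩
    have a := kk_formula hc h0 h1
    have b := kk_formula hv h0 h1
    have d := kk_formula (mul_pos hc hv) h0 h1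
    rw [Real.mul_rpow hc.le hv.le] at d
    have hne : α * (α - 1) ≠ 0 := mul_ne_zero h0 h1'
    apply mul_left_cancel₀ hne
    have e : α * (α - 1) * (c ^ α * kk v α + (c ^ α - c) / (α - 1) * (v - 1)) =
      c ^ α * (α * (α - 1) * kk v α) + α * (c ^ α - c) * (v - 1) := by field_simp
    rw [e, b, mul_sub, d, a]; ring
  obtain ⟨d, hd⟩ := key
  rw [Finset.sum_congr rfl fun i _ => hd (x i) (hx i), Finset.sum_add_distrib, ← Finset.mul_sum,
    ← Finset.mul_sum, hs]
  ring

/-- difference functional -/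
noncomputable def DD {ι : Type*} [Fintype ι] (P Q : ι → ℝ) (α : ℝ) : ℝ :=
  ∑ i, kk (P i) α - ∑ i, kk (Q i) α

theorem DD_formula {ι : Type*} [Fintype ι] {P Q : ι → ℝ} (hP : ∀ i, 0 < P i) (hQ : ∀ i, 0 < Q i)
    (h : ∑ i, P i = ∑ i, Q i) {α : ℝ} (h0 : α ≠ 0) (h1 : α ≠ 1) :
    α * (α - 1) * DD P Q α = ∑ i, P i ^ α - ∑ i, Q i ^ α := by
  unfold DD
  rw [mul_sub, Finset.mul_sum, Finset.mul_sum,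
    Finset.sum_congr rfl fun i _ => kk_formula (hP i) h0 h1,
    Finset.sum_congr rfl fun i _ => kk_formula (hQ i) h0 h1]
  simp only [Finset.sum_sub_distrib, ← Finset.mul_sum, h]
  ring

theorem DD_zero {ι : Type*} [Fintype ι] {P Q : ι → ℝ} (hP : ∀ i, 0 < P i) (hQ : ∀ i, 0 < Q i)
    (h : ∑ i, P i = ∑ i, Q i) :
    DD P Q 0 = ∑ i, Real.log (Q i) - ∑ i, Real.log (P i) := by
  unfold DD
  rw [Finset.sum_congr rfl fun i _ => kk_zero (hP i),
    Finset.sum_congr rfl fun i _ => kk_zero (hQ i)]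
  simp only [Finset.sum_sub_distrib, h]
  ring

theorem DD_one {ι : Type*} [Fintype ι] {P Q : ι → ℝ} (hP : ∀ i, 0 < P i) (hQ : ∀ i, 0 < Q i)
    (h : ∑ i, P i = ∑ i, Q i) :
    DD P Q 1 = ∑ i, P i * Real.log (P i) - ∑ i, Q i * Real.log (Q i) := by
  unfold DD
  rw [Finset.sum_congr rfl fun i _ => kk_one (hP i),
    Finset.sum_congr rfl fun i _ => kk_one (hQ i)]
  simp only [Finset.sum_sub_distrib, h]
  ring

theorem DD_cont_alpha {ι : Type*} [Fintype ι] {P Q : ι → ℝ} (hP : ∀ i, 0 < P i)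
    (hQ : ∀ i, 0 < Q i) : Continuous (DD P Q) := by
  unfold DD
  exact (continuous_finsetSum _ fun i _ => kk_cont_alpha (hP i)).sub
    (continuous_finsetSum _ fun i _ => kk_cont_alpha (hQ i))

end Part3

section Part4
open Polynomial

/-- the functional `X^k ↦ φ(λ^k)` -/
noncomputable def LL (φ : ℝ → ℝ) (l : ℝ) : ℝ[X] →ₗ[ℝ] ℝ :=
  Polynomial.lsum (fun k => (φ (l ^ k)) • (LinearMap.id : ℝ →ₗ[ℝ] ℝ))

theorem LL_monomial (φ : ℝ → ℝ) (l c : ℝ) (k : ℕ) : LL φ l (monomial k c) = c * φ (l ^ k) := by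
  simp [LL, Polynomial.lsum_apply, Polynomial.sum_monomial_index, mul_comm]

theorem LL_X_pow (φ : ℝ → ℝ) (l : ℝ) (k : ℕ) : LL φ l (X ^ k) = φ (l ^ k) := by
  rw [X_pow_eq_monomial, LL_monomial, one_mul]

theorem LL_nonneg (φ : ℝ → ℝ) (l : ℝ) (hl : 0 < l)
    (hφ : ∀ x y : ℝ, (1 + l) * φ ((x + l * y) / (1 + l)) ≤ φ x + l * φ y) (h : ℝ[X]) (hn : NN h) :
    0 ≤ LL φ l ((X - 1) * (X - C l) * h) := by
  conv_rhs => rw [h.as_sum_range_C_mul_X_pow]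
  rw [Finset.mul_sum, map_sum]
  refine Finset.sum_nonneg fun k _ => ?_
  have e : (X - 1) * (X - C l) * (C (h.coeff k) * X ^ k) =
      h.coeff k • (X ^ (k + 2) - (1 + l) • X ^ (k + 1) + l • X ^ k) := by
    simp only [smul_eq_C_mul, C_add, C_1]; ring
  rw [e]
  simp only [map_smul, map_add, map_sub, LL_X_pow, smul_eq_mul]
  refine mul_nonneg (hn k) ?_
  have := hφ (l ^ (k + 2)) (l ^ k)
  have e2 : (l ^ (k + 2) + l * l ^ k) / (1 + l) = l ^ (k + 1) := by
    field_simp; ring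
  rw [e2] at this
  linarith

theorem poly_hinge {ι : Type*} [Fintype ι] (a b : ι → ℕ) (l c : ℝ) (hl : 0 < l) (hl1 : l < 1)
    (hc : 0 < c) (P Q : ι → ℝ) (hP : ∀ i, P i = c * l ^ a i) (hQ : ∀ i, Q i = c * l ^ b i)
    (hsum : ∑ i, P i = ∑ i, Q i) (hD : ∀ α, 0 < DD P Q α) :
    ∃ (N : ℕ) (r : Finset (Fin N) → ℝ), IsProbDist r ∧ Hinge (kron P r) (kron Q r) := by
  have hPpos : ∀ i, 0 < P i := fun i => by rw [hP]; positivity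
  have hQpos : ∀ i, 0 < Q i := fun i => by rw [hQ]; positivity
  have hlog : Real.log l < 0 := Real.log_neg hl hl1
  set f : ℝ[X] := ∑ i, X ^ a i - ∑ i, X ^ b i with hf
  have fev : ∀ x, f.eval x = ∑ i, x ^ a i - ∑ i, x ^ b i := by
    intro x; simp [hf, eval_finsetSum]
  have f1 : f.eval 1 = 0 := by rw [fev]; simp
  have fl : f.eval l = 0 := by
    rw [fev]
    simp only [hP, hQ, ← Finset.mul_sum] at hsum
    exact sub_eq_zero.2 (mul_left_cancel₀ hc.ne' hsum)
  obtain ⟨f1', hf1⟩ := dvd_iff_isRoot.2 (show f.IsRoot 1 from f1)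
  have fl' : f1'.eval l = 0 := by
    rw [hf1] at fl
    simp only [eval_mul, eval_sub, eval_X, eval_C] at fl
    rcases mul_eq_zero.1 fl with h | h
    · linarith
    · exact h
  obtain ⟨g, hg⟩ := dvd_iff_isRoot.2 (show f1'.IsRoot l from fl')
  have hfg : f = (X - 1) * (X - C l) * g := by rw [hf1, hg, C_1]; ring
  have fder : ∀ x, f.derivative.eval x = ∑ i, (a i : ℝ) * x ^ (a i - 1) - ∑ i, (b i : ℝ) * x ^ (b i - 1) := by
    intro x; simp [hf, eval_finsetSum, derivative_X_pow]
  have fder2 : ∀ x, f.derivative.eval x = ((x - l) + (x - 1)) * g.eval x +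
      (x - 1) * (x - l) * g.derivative.eval x := by
    intro x; rw [hfg]; simp [derivative_mul]
  have hlogP : ∀ i, Real.log (P i) = Real.log c + a i * Real.log l := fun i => by
    rw [hP, Real.log_mul hc.ne' (by positivity), Real.log_pow]
  have hlogQ : ∀ i, Real.log (Q i) = Real.log c + b i * Real.log l := fun i => by
    rw [hQ, Real.log_mul hc.ne' (by positivity), Real.log_pow]
  have gpos : ∀ x, 0 < x → 0 < g.eval x := by
    intro x hx
    by_cases hx1 : x = 1
    · subst hx1
      have h0 := hD 0
      rw [DD_zero hPpos hQpos hsum] at h0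
      have e := fder2 1
      rw [fder] at e
      simp only [hlogP, hlogQ, Finset.sum_add_distrib, ← Finset.sum_mul] at h0
      simp only [one_pow, mul_one, sub_self, add_zero, zero_mul] at e
      have h2 : 0 < (-Real.log l) * (∑ i, (a i : ℝ) - ∑ i, (b i : ℝ)) := by linarith
      have h3 := pos_of_mul_pos_right h2 (by linarith)
      rw [e] at h3
      exact pos_of_mul_pos_right h3 (by linarith)
    by_cases hxl : x = l
    · subst hxl
      have h0 := hD 1
      rw [DD_one hPpos hQpos hsum] at h0
      have e := fder2 x
      rw [fder] at e
      have e1 : ∀ n : ℕ, (n : ℝ) * x ^ n = x * (n * x ^ (n - 1)) := by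
        intro n; rcases n with _ | n
        · simp
        · simp; ring
      have key : ∀ d : ι → ℕ, ∑ i, (c * x ^ d i) * (Real.log c + d i * Real.log x) =
          Real.log c * ∑ i, c * x ^ d i + c * Real.log x * x * ∑ i, (d i : ℝ) * x ^ (d i - 1) := by
        intro d
        rw [Finset.mul_sum, Finset.mul_sum, ← Finset.sum_add_distrib]
        refine Finset.sum_congr rfl fun i _ => ?_
        linear_combination (c * Real.log x) * e1 (d i)
      have kP : ∑ i, P i * Real.log (P i) = Real.log c * ∑ i, P i + c * Real.log x * x * ∑ i, (a i : ℝ) * x ^ (a i - 1) := by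
        simp only [hlogP]; simp only [hP]; exact key a
      have kQ : ∑ i, Q i * Real.log (Q i) = Real.log c * ∑ i, Q i + c * Real.log x * x * ∑ i, (b i : ℝ) * x ^ (b i - 1) := by
        simp only [hlogQ]; simp only [hQ]; exact key b
      rw [kP, kQ, hsum] at h0
      simp only [sub_self, zero_add, mul_zero, zero_mul, add_zero] at e
      have h2 : 0 < (c * (-Real.log x) * x) * ((1 - x) * g.eval x) := by
        have : (1 - x) * g.eval x = -(∑ i, (a i : ℝ) * x ^ (a i - 1) - ∑ i, (b i : ℝ) * x ^ (b i - 1)) := by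
          rw [e]; ring
        rw [this]; linarith
      have hlx : 0 < -Real.log x := by linarith
      have h3 := pos_of_mul_pos_right h2 (by positivity)
      exact pos_of_mul_pos_right h3 (by linarith)
    · set α := Real.log x / Real.log l with hα
      have hαx : x = l ^ α := by
        rw [Real.rpow_def_of_pos hl, hα, mul_div_cancel₀ _ hlog.ne, Real.exp_log hx]
      have hα0 : α ≠ 0 := by intro h; rw [h, Real.rpow_zero] at hαx; exact hx1 hαx
      have hα1 : α ≠ 1 := by intro h; rw [h, Real.rpow_one] at hαx; exact hxl hαx
      have h0 := DD_formula hPpos hQpos hsum hα0 hα1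
      have key : ∀ n : ℕ, (c * l ^ n) ^ α = c ^ α * x ^ n := by
        intro n
        rw [Real.mul_rpow hc.le (by positivity), hαx, ← Real.rpow_natCast, ← Real.rpow_natCast,
          ← Real.rpow_mul hl.le, ← Real.rpow_mul hl.le, mul_comm (n : ℝ)]
      simp only [hP, hQ, key, ← Finset.mul_sum] at h0
      rw [← mul_sub, ← fev, hfg] at h0
      simp only [eval_mul, eval_sub, eval_X, eval_C, eval_one] at h0
      have hDα := hD α
      have hca : 0 < c ^ α := by positivity
      -- signs
      have hs : 0 < (α * (α - 1)) * ((x - 1) * (x - l)) := by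
        have s1 : 0 < -(α * (x - 1)) := by
          rcases lt_or_gt_of_ne hα0 with h | h
          · have : 1 < x := by rw [hαx]; exact Real.one_lt_rpow_of_pos_of_lt_one_of_neg hl hl1 h
            nlinarith
          · have : x < 1 := by rw [hαx]; exact Real.rpow_lt_one hl.le hl1 h
            nlinarith
        have s2 : 0 < -((α - 1) * (x - l)) := by
          rcases lt_or_gt_of_ne hα1 with h | h
          · have : l < x := by
              rw [hαx]
              conv_lhs => rw [← Real.rpow_one l]
              exact Real.rpow_lt_rpow_of_exponent_gt hl hl1 h
            nlinarith
          · have : x < l := by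
              rw [hαx]
              conv_rhs => rw [← Real.rpow_one l]
              exact Real.rpow_lt_rpow_of_exponent_gt hl hl1 h
            nlinarith
        nlinarith [mul_pos s1 s2]
      have h5 : 0 < (α * (α - 1)) ^ 2 * DD P Q α :=
        mul_pos (by have := sub_ne_zero.2 hα1; positivity) hDα
      have h6 : (α * (α - 1)) ^ 2 * DD P Q α =
          (c ^ α * ((α * (α - 1)) * ((x - 1) * (x - l)))) * g.eval x := by
        linear_combination (α * (α - 1)) * h0
      rw [h6] at h5
      exact pos_of_mul_pos_right h5 (by positivity)
  obtain ⟨N, hN⟩ := polya g gpos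
  have hZ : ∑ s : Finset (Fin N), l ^ s.card = (l + 1) ^ N := by
    have := Fintype.sum_pow_mul_eq_add_pow (Fin N) l 1
    simpa using this
  have hZX : ∑ s : Finset (Fin N), (X : ℝ[X]) ^ s.card = (1 + X) ^ N := by
    have := Fintype.sum_pow_mul_eq_add_pow (Fin N) (X : ℝ[X]) 1
    rw [add_comm]
    simpa using this
  refine ⟨N, fun s => l ^ s.card / (l + 1) ^ N, ⟨fun s => by positivity, ?_⟩, ?_⟩
  · rw [← Finset.sum_div, hZ]; exact div_self (by positivity)
  · intro t ht
    set κ := c / (l + 1) ^ N with hκ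
    set φ : ℝ → ℝ := fun u => max (κ * u - t) 0 with hφ
    have hφc : ∀ x y : ℝ, (1 + l) * φ ((x + l * y) / (1 + l)) ≤ φ x + l * φ y := by
      intro x y
      have hl' : 0 < 1 + l := by linarith
      simp only [hφ]
      rw [mul_max_of_nonneg _ _ hl'.le, mul_zero]
      have a1 := le_max_left (κ * x - t) 0
      have a2 := le_max_right (κ * x - t) 0
      have b1 := mul_le_mul_of_nonneg_left (le_max_left (κ * y - t) 0) hl.le
      have b2 := mul_le_mul_of_nonneg_left (le_max_right (κ * y - t) 0) hl.le
      refine max_le ?_ (by linarith)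
      have : (1 + l) * (κ * ((x + l * y) / (1 + l)) - t) = (κ * x - t) + l * (κ * y - t) := by
        field_simp; ring
      linarith
    have h1 := LL_nonneg φ l hl hφc _ hN
    have e1 : (X - 1) * (X - C l) * ((1 + X) ^ N * g) =
        (∑ i, ∑ s : Finset (Fin N), X ^ (a i + s.card)) - ∑ i, ∑ s : Finset (Fin N), X ^ (b i + s.card) := by
      have : (X - 1) * (X - C l) * ((1 + X) ^ N * g) = f * (1 + X) ^ N := by rw [hfg]; ring
      rw [this, hf, ← hZX, sub_mul, Finset.sum_mul_sum, Finset.sum_mul_sum]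
      simp only [pow_add]
    rw [e1] at h1
    simp only [map_sub, map_sum, LL_X_pow] at h1
    have e2 : ∀ (d : ι → ℕ) (R : ι → ℝ), (∀ i, R i = c * l ^ d i) →
        ∑ x : ι × Finset (Fin N), max (kron R (fun s : Finset (Fin N) => l ^ s.card / (l + 1) ^ N) x - t) 0 =
        ∑ i, ∑ s : Finset (Fin N), φ (l ^ (d i + s.card)) := by
      intro d R hR
      rw [Fintype.sum_prod_type]
      refine Finset.sum_congr rfl fun i _ => Finset.sum_congr rfl fun s _ => ?_
      simp only [kron, hφ, hR, hκ]
      congr 2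
      rw [pow_add]; ring
    rw [e2 a P hP, e2 b Q hQ]
    linarith

end Part4

section Part5
open scoped Topology
open Filter

/-- log-coordinates difference functional positive on a neighbourhood -/
theorem DD_nhds {ι : Type*} [Fintype ι] (X Y : ι → ℝ) (i0 i1 : ι)
    (h0 : ∀ j, Y j < X i0) (h1 : ∀ j, X i1 < Y j)
    (hD : ∀ α, 0 < DD (fun i => Real.exp (X i)) (fun i => Real.exp (Y i)) α) :
    ∀ᶠ z : (ι → ℝ) × (ι → ℝ) in 𝓝 (X, Y),
      ∑ i, Real.exp (z.1 i) = ∑ i, Real.exp (z.2 i) →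
      ∀ α, 0 < DD (fun i => Real.exp (z.1 i)) (fun i => Real.exp (z.2 i)) α := by
  obtain ⟨j0, -, hj0⟩ := Finset.exists_max_image Finset.univ Y ⟨i0, Finset.mem_univ _⟩
  obtain ⟨j1, -, hj1⟩ := Finset.exists_min_image Finset.univ Y ⟨i0, Finset.mem_univ _⟩
  obtain ⟨c, hc, hc0, hc1⟩ : ∃ c : ℝ, 0 < c ∧ (∀ j, Y j + c < X i0) ∧ ∀ j, X i1 + c < Y j := by
    refine ⟨min (X i0 - Y j0) (Y j1 - X i1) / 2, ?_, ?_, ?_⟩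
    · have := h0 j0; have := h1 j1
      have : 0 < min (X i0 - Y j0) (Y j1 - X i1) := lt_min (by linarith) (by linarith)
      linarith
    · intro j
      have := hj0 j (Finset.mem_univ _); have := h0 j0
      have := min_le_left (X i0 - Y j0) (Y j1 - X i1)
      linarith
    · intro j
      have := hj1 j (Finset.mem_univ _); have := h1 j1
      have := min_le_right (X i0 - Y j0) (Y j1 - X i1)
      linarith
  set d : ℝ := (Fintype.card ι : ℝ) with hd
  have hdpos : 0 < d := by
    have : 0 < Fintype.card ι := Fintype.card_pos_iff.2 ⟨i0⟩
    exact Nat.cast_pos.2 this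
  obtain ⟨M, hM1, hM⟩ : ∃ M : ℝ, 1 < M ∧ d ≤ Real.exp (M * c) := by
    refine ⟨max 2 (d / c), lt_of_lt_of_le one_lt_two (le_max_left _ _), ?_⟩
    have h2 : d ≤ max 2 (d / c) * c := by
      have := mul_le_mul_of_nonneg_right (le_max_right 2 (d / c)) hc.le
      rwa [div_mul_cancel₀ _ hc.ne'] at this
    exact h2.trans (by linarith [Real.add_one_le_exp (max 2 (d / c) * c)])
  have ev0 : ∀ᶠ z : (ι → ℝ) × (ι → ℝ) in 𝓝 (X, Y), ∀ j, z.2 j + c < z.1 i0 := by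
    rw [eventually_all]; intro j
    refine (IsOpen.mem_nhds (s := {z : (ι → ℝ) × (ι → ℝ) | z.2 j + c < z.1 i0}) ?_ (hc0 j))
    exact isOpen_lt (by fun_prop) (by fun_prop)
  have ev1 : ∀ᶠ z : (ι → ℝ) × (ι → ℝ) in 𝓝 (X, Y), ∀ j, z.1 i1 + c < z.2 j := by
    rw [eventually_all]; intro j
    refine (IsOpen.mem_nhds (s := {z : (ι → ℝ) × (ι → ℝ) | z.1 i1 + c < z.2 j}) ?_ (hc1 j))
    exact isOpen_lt (by fun_prop) (by fun_prop)
  have hcont : Continuous (fun w : ((ι → ℝ) × (ι → ℝ)) × ℝ =>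
      DD (fun i => Real.exp (w.1.1 i)) (fun i => Real.exp (w.1.2 i)) w.2) := by
    unfold DD
    refine Continuous.sub (continuous_finsetSum _ fun i _ => ?_)
      (continuous_finsetSum _ fun i _ => ?_)
    · exact kk_exp_continuous.comp
        (g := fun z : ℝ × ℝ => kk (Real.exp z.1) z.2)
        (f := fun w : ((ι → ℝ) × (ι → ℝ)) × ℝ => (w.1.1 i, w.2)) (by fun_prop)
    · exact kk_exp_continuous.comp
        (g := fun z : ℝ × ℝ => kk (Real.exp z.1) z.2)
        (f := fun w : ((ι → ℝ) × (ι → ℝ)) × ℝ => (w.1.2 i, w.2)) (by fun_prop)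
  have ev2 : ∀ᶠ z : (ι → ℝ) × (ι → ℝ) in 𝓝 (X, Y), ∀ α ∈ Set.Icc (-M) M,
      0 < DD (fun i => Real.exp (z.1 i)) (fun i => Real.exp (z.2 i)) α := by
    apply isCompact_Icc.eventually_forall_of_forall_eventually
    intro α _
    exact hcont.continuousAt.eventually (lt_mem_nhds (hD α))
  filter_upwards [ev0, ev1, ev2] with z g0 g1 g2 hs α
  by_cases hα : α ∈ Set.Icc (-M) M
  · exact g2 α hα
  have hcase : α < -M ∨ M < α := by
    by_contra hh; push Not at hh; exact hα ⟨hh.1, hh.2⟩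
  have hne0 : α ≠ 0 := by rintro rfl; rcases hcase with h | h <;> linarith
  have hne1 : α ≠ 1 := by rintro rfl; rcases hcase with h | h <;> linarith
  have hpos : 0 < α * (α - 1) := by
    rcases hcase with h | h
    · exact mul_pos_of_neg_of_neg (by linarith) (by linarith)
    · exact mul_pos (by linarith) (by linarith)
  have hF := DD_formula (P := fun i => Real.exp (z.1 i)) (Q := fun i => Real.exp (z.2 i))
    (fun i => Real.exp_pos _) (fun i => Real.exp_pos _) hs hne0 hne1
  refine pos_of_mul_pos_right (a := α * (α - 1)) ?_ hpos.le
  rw [hF, sub_pos]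
  simp only [← Real.exp_mul]
  have fin : ∀ i, (∀ j, z.2 j * α < z.1 i * α - M * c) →
      ∑ j, Real.exp (z.2 j * α) < ∑ j, Real.exp (z.1 j * α) := by
    intro i hi
    calc ∑ j, Real.exp (z.2 j * α) < ∑ j : ι, Real.exp (z.1 i * α) / d := by
          refine Finset.sum_lt_sum_of_nonempty ⟨i0, Finset.mem_univ _⟩ fun j _ => ?_
          calc _ < Real.exp (z.1 i * α - M * c) := Real.exp_lt_exp.2 (hi j)
            _ = Real.exp (z.1 i * α) / Real.exp (M * c) := Real.exp_sub _ _
            _ ≤ _ := div_le_div_of_nonneg_left (Real.exp_pos _).le hdpos hM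
      _ = Real.exp (z.1 i * α) := by
          rw [Finset.sum_const, Finset.card_univ, nsmul_eq_mul, ← hd]; field_simp
      _ ≤ _ := Finset.single_le_sum (f := fun j => Real.exp (z.1 j * α))
          (fun j _ => (Real.exp_pos _).le) (Finset.mem_univ i)
  rcases hcase with h | h
  · refine fin i1 fun j => ?_
    have := g1 j
    nlinarith
  · refine fin i0 fun j => ?_
    have := g0 j
    nlinarith

theorem lattice_approx {ι : Type*} [Fintype ι] [Nonempty ι] (X Y : ι → ℝ)
    (hX1 : ∑ i, Real.exp (X i) = 1)
    (hX : ∀ i, X i ≤ 0) (hY : ∀ i, Y i ≤ 0)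
    (hgt : ∀ s, 1 < s → ∑ i, Real.exp (s * Y i) < ∑ i, Real.exp (s * X i))
    (hlt : ∀ s, 0 < s → s < 1 → ∑ i, Real.exp (s * X i) < ∑ i, Real.exp (s * Y i))
    (O : Set ((ι → ℝ) × (ι → ℝ))) (hO : O ∈ 𝓝 (X, Y)) :
    ∃ (h C : ℝ) (a b : ι → ℕ), 0 < h ∧
      ((fun i => C - h * a i, fun i => C - h * b i) : (ι → ℝ) × (ι → ℝ)) ∈ O ∧
      ∑ i, Real.exp (C - h * a i) = 1 ∧ ∑ i, Real.exp (C - h * b i) = 1 := by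
  have hZpos : ∀ (s : ℝ) (x : ι → ℝ), 0 < ∑ i, Real.exp (s * x i) := fun s x =>
    Finset.sum_pos (fun i _ => Real.exp_pos _) Finset.univ_nonempty
  let Ψ : ℝ × ((ι → ℝ) × (ι → ℝ)) → (ι → ℝ) × (ι → ℝ) := fun w =>
    (fun i => w.1 * w.2.1 i - Real.log (∑ i, Real.exp (w.1 * w.2.1 i)),
     fun i => w.1 * w.2.2 i - Real.log (∑ i, Real.exp (w.1 * w.2.1 i)))
  have hΨ : Continuous Ψ := by
    have hl : Continuous (fun w : ℝ × ((ι → ℝ) × (ι → ℝ)) =>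
        Real.log (∑ i, Real.exp (w.1 * w.2.1 i))) :=
      Continuous.log (by fun_prop) (fun w => (hZpos _ _).ne')
    refine Continuous.prodMk (continuous_pi fun i => ?_) (continuous_pi fun i => ?_)
    · exact Continuous.sub (by fun_prop) hl
    · exact Continuous.sub (by fun_prop) hl
  have hΨ1 : Ψ (1, (X, Y)) = (X, Y) := by
    simp only [Ψ, one_mul, hX1, Real.log_one, sub_zero]
  have hev : ∀ᶠ w in 𝓝 ((1 : ℝ), (X, Y)), Ψ w ∈ O := by
    have := hΨ.continuousAt (x := ((1 : ℝ), (X, Y)))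
    unfold ContinuousAt at this
    rw [hΨ1] at this
    exact this hO
  rw [nhds_prod_eq, eventually_prod_iff] at hev
  obtain ⟨p1, hp1, p2, hp2, hpp⟩ := hev
  obtain ⟨σ', hσ', hb⟩ := Metric.eventually_nhds_iff.1 hp1
  set σ := min (σ' / 2) (1 / 2) with hσ
  have hσpos : 0 < σ := lt_min (by linarith) (by norm_num)
  have hσ1 : σ ≤ σ' / 2 := min_le_left _ _
  have hσ2 : σ ≤ 1 / 2 := min_le_right _ _
  have c1 : Continuous (fun w : (ι → ℝ) × (ι → ℝ) =>
      ∑ i, Real.exp ((1 + σ) * w.1 i) - ∑ i, Real.exp ((1 + σ) * w.2 i)) := by fun_prop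
  have c2 : Continuous (fun w : (ι → ℝ) × (ι → ℝ) =>
      ∑ i, Real.exp ((1 - σ) * w.1 i) - ∑ i, Real.exp ((1 - σ) * w.2 i)) := by fun_prop
  have e1 := (c1.continuousAt (x := (X, Y))).eventually (lt_mem_nhds (sub_pos.2 (hgt (1 + σ) (by linarith))))
  have e2 := (c2.continuousAt (x := (X, Y))).eventually
    (gt_mem_nhds (sub_neg.2 (hlt (1 - σ) (by linarith) (by linarith))))
  obtain ⟨δ, hδ, hball⟩ := Metric.eventually_nhds_iff.1 ((hp2.and e1).and e2)
  set h := δ / 2 with hh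
  have hhpos : 0 < h := by linarith
  let a : ι → ℕ := fun i => ⌊-X i / h⌋₊
  let b : ι → ℕ := fun i => ⌊-Y i / h⌋₊
  have hfl : ∀ x : ℝ, x ≤ 0 → |(-(h * (⌊-x / h⌋₊ : ℝ))) - x| ≤ h := by
    intro x hx
    have h1 : (0:ℝ) ≤ -x / h := div_nonneg (by linarith) hhpos.le
    have h2 := Nat.floor_le h1
    have h3 := Nat.lt_floor_add_one (-x / h)
    rw [le_div_iff₀ hhpos] at h2
    rw [div_lt_iff₀ hhpos] at h3
    rw [abs_le]; constructor <;> nlinarith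
  let x : ι → ℝ := fun i => -(h * a i)
  let y : ι → ℝ := fun i => -(h * b i)
  have hdist : dist (x, y) (X, Y) < δ := by
    refine lt_of_le_of_lt (b := h) ?_ (by linarith)
    rw [Prod.dist_eq]
    refine max_le ?_ ?_
    · exact (dist_pi_le_iff hhpos.le).2 fun i => by rw [Real.dist_eq]; exact hfl _ (hX i)
    · exact (dist_pi_le_iff hhpos.le).2 fun i => by rw [Real.dist_eq]; exact hfl _ (hY i)
  obtain ⟨⟨g1, g2⟩, g3⟩ := hball hdist
  have hcs : Continuous (fun s : ℝ => ∑ i, Real.exp (s * x i) - ∑ i, Real.exp (s * y i)) := by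
    fun_prop
  obtain ⟨s, hs, hs0⟩ := intermediate_value_Icc (by linarith : 1 - σ ≤ 1 + σ) hcs.continuousOn
    (show (0 : ℝ) ∈ _ from ⟨g3.le, g2.le⟩)
  have hs0' : ∑ i, Real.exp (s * x i) = ∑ i, Real.exp (s * y i) := sub_eq_zero.1 hs0
  have hmem : Ψ (s, (x, y)) ∈ O := by
    refine hpp (hb ?_) g1
    rw [Real.dist_eq]
    have := hs.1; have := hs.2
    refine lt_of_le_of_lt (b := σ) (abs_le.2 ⟨by linarith, by linarith⟩) (by linarith)
  set Z := ∑ i, Real.exp (s * x i) with hZ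
  have hZp : 0 < Z := hZpos s x
  refine ⟨s * h, -Real.log Z, a, b, mul_pos (by linarith [hs.1]) hhpos, ?_, ?_, ?_⟩
  · convert hmem using 2
    · funext i; simp only [x, ← hZ]; ring
    · funext i; simp only [y, ← hZ]; ring
  · have : ∀ i, Real.exp (-Real.log Z - s * h * a i) = Real.exp (s * x i) / Z := by
      intro i
      rw [show -Real.log Z - s * h * a i = s * x i - Real.log Z by simp only [x]; ring,
        Real.exp_sub, Real.exp_log hZp]
    simp only [this, ← Finset.sum_div, ← hZ]
    exact div_self hZp.ne'
  · have : ∀ i, Real.exp (-Real.log Z - s * h * b i) = Real.exp (s * y i) / Z := by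
      intro i
      rw [show -Real.log Z - s * h * b i = s * y i - Real.log Z by simp only [y]; ring,
        Real.exp_sub, Real.exp_log hZp]
    simp only [this, ← Finset.sum_div, ← hs0']
    exact div_self hZp.ne'

end Part5

section Part6
open scoped Topology
open Filter

theorem trump_strict {ι : Type*} [Fintype ι] (P Q : ι → ℝ) (hP : ∀ i, 0 < P i) (hQ : ∀ i, 0 < Q i)
    (hP1 : ∑ i, P i = 1) (hQ1 : ∑ i, Q i = 1) (i0 i1 j0 : ι)
    (h0 : ∀ j, Q j < P i0) (h1 : ∀ j, P i1 < Q j) (hj0 : 1 / (Fintype.card ι : ℝ) < Q j0)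
    (hD : ∀ α, 0 < DD P Q α) :
    ∃ (N : ℕ) (r : Finset (Fin N) → ℝ), IsProbDist r ∧ Hinge (kron P r) (kron Q r) := by
  have : Nonempty ι := ⟨i0⟩
  set n : ℝ := (Fintype.card ι : ℝ) with hn
  have hnpos : 0 < n := by
    have : 0 < Fintype.card ι := Fintype.card_pos
    exact Nat.cast_pos.2 this
  have hsumc : ∑ _i : ι, 1 / n = 1 := by
    rw [Finset.sum_const, Finset.card_univ, nsmul_eq_mul, ← hn]; field_simp
  let P2 : ℝ → ι → ℝ := fun ε i => (1 - ε) * P i + ε * (1 / n)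
  let Q2 : ℝ → ι → ℝ := fun ε i => (1 + ε) * Q i - ε * (1 / n)
  have hP2 : ∀ i, Continuous (fun ε => P2 ε i) := fun i => by simp only [P2]; fun_prop
  have hQ2 : ∀ i, Continuous (fun ε => Q2 ε i) := fun i => by simp only [Q2]; fun_prop
  have hP20 : ∀ i, P2 0 i = P i := fun i => by simp [P2]
  have hQ20 : ∀ i, Q2 0 i = Q i := fun i => by simp [Q2]
  have evP : ∀ᶠ ε in 𝓝 (0:ℝ), ∀ i, 0 < P2 ε i := by
    rw [eventually_all]; intro i
    exact (hP2 i).continuousAt.eventually (lt_mem_nhds (by beta_reduce; rw [hP20]; exact hP i))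
  have evQ : ∀ᶠ ε in 𝓝 (0:ℝ), ∀ i, 0 < Q2 ε i := by
    rw [eventually_all]; intro i
    exact (hQ2 i).continuousAt.eventually (lt_mem_nhds (by beta_reduce; rw [hQ20]; exact hQ i))
  have hten : Tendsto (fun ε => ((fun i => Real.log (P2 ε i), fun i => Real.log (Q2 ε i)) :
      (ι → ℝ) × (ι → ℝ))) (𝓝 0) (𝓝 (fun i => Real.log (P i), fun i => Real.log (Q i))) := by
    refine Tendsto.prodMk_nhds ?_ ?_
    · rw [tendsto_pi_nhds]; intro i
      have := ((hP2 i).tendsto 0).log (by rw [hP20]; exact (hP i).ne')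
      rwa [hP20] at this
    · rw [tendsto_pi_nhds]; intro i
      have := ((hQ2 i).tendsto 0).log (by rw [hQ20]; exact (hQ i).ne')
      rwa [hQ20] at this
  have hg := DD_nhds (fun i => Real.log (P i)) (fun i => Real.log (Q i)) i0 i1
    (fun j => Real.log_lt_log (hQ j) (h0 j)) (fun j => Real.log_lt_log (hP i1) (h1 j))
    (by simpa only [Real.exp_log (hP _), Real.exp_log (hQ _)] using hD)
  have hgood := hten.eventually hg.eventually_nhds
  have hall : ∀ᶠ ε in 𝓝[>] (0:ℝ), (0 < ε ∧ ε < 1) ∧ (∀ i, 0 < P2 ε i) ∧ (∀ i, 0 < Q2 ε i) ∧ _ :=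
    ((eventually_mem_nhdsWithin.and ((gt_mem_nhds one_pos).filter_mono nhdsWithin_le_nhds)).and
      ((evP.filter_mono nhdsWithin_le_nhds).and ((evQ.filter_mono nhdsWithin_le_nhds).and
        (hgood.filter_mono nhdsWithin_le_nhds))))
  obtain ⟨ε, ⟨hε, hε1⟩, hPp, hQp, hgd⟩ := hall.exists
  have hP2s : ∑ i, P2 ε i = 1 := by
    simp only [P2]
    rw [Finset.sum_add_distrib, ← Finset.mul_sum, ← Finset.mul_sum, hP1, hsumc]; ring
  have hQ2s : ∑ i, Q2 ε i = 1 := by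
    simp only [Q2]
    rw [Finset.sum_sub_distrib, ← Finset.mul_sum, ← Finset.mul_sum, hQ1, hsumc]; ring
  have hDc := hgd.self_of_nhds (by simp only [Real.exp_log (hPp _), Real.exp_log (hQp _), hP2s, hQ2s])
  have hsumeq : ∑ i, Real.exp (Real.log (P2 ε i)) = ∑ i, Real.exp (Real.log (Q2 ε i)) := by
    simp only [Real.exp_log (hPp _), Real.exp_log (hQp _), hP2s, hQ2s]
  have hform : ∀ s : ℝ, s ≠ 0 → s ≠ 1 → s * (s - 1) * DD (fun i => Real.exp (Real.log (P2 ε i)))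
      (fun i => Real.exp (Real.log (Q2 ε i))) s =
      ∑ i, Real.exp (s * Real.log (P2 ε i)) - ∑ i, Real.exp (s * Real.log (Q2 ε i)) := by
    intro s a b
    rw [DD_formula (fun i => Real.exp_pos _) (fun i => Real.exp_pos _) hsumeq a b]
    simp only [← Real.exp_mul, mul_comm s]
  have hle : ∀ R : ι → ℝ, (∀ i, 0 < R i) → ∑ i, R i = 1 → ∀ i, Real.log (R i) ≤ 0 := by
    intro R hR hs i
    refine Real.log_nonpos (hR i).le ?_
    rw [← hs]
    exact Finset.single_le_sum (fun j _ => (hR j).le) (Finset.mem_univ i)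
  set η := (Q j0 - 1 / n) / (2 * n + 2) with hη
  have hηpos : 0 < η := div_pos (by linarith) (by positivity)
  have hηe : (2 * n + 2) * η = Q j0 - 1 / n := by rw [hη]; field_simp
  have hεη : 0 < ε * η := mul_pos hε hηpos
  have ev3 : ∀ᶠ z : (ι → ℝ) × (ι → ℝ) in 𝓝 (fun i => Real.log (P2 ε i), fun i => Real.log (Q2 ε i)),
      ∀ i, |Real.exp (z.1 i) - P2 ε i| < ε * η := by
    rw [eventually_all]; intro i
    have hc : Continuous (fun z : (ι → ℝ) × (ι → ℝ) => |Real.exp (z.1 i) - P2 ε i|) := by fun_prop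
    refine (hc.tendsto _).eventually (gt_mem_nhds ?_)
    simpa [Real.exp_log (hPp i)] using hεη
  have ev4 : ∀ᶠ z : (ι → ℝ) × (ι → ℝ) in 𝓝 (fun i => Real.log (P2 ε i), fun i => Real.log (Q2 ε i)),
      ∀ i, |Real.exp (z.2 i) - Q2 ε i| < ε * η := by
    rw [eventually_all]; intro i
    have hc : Continuous (fun z : (ι → ℝ) × (ι → ℝ) => |Real.exp (z.2 i) - Q2 ε i|) := by fun_prop
    refine (hc.tendsto _).eventually (gt_mem_nhds ?_)
    simpa [Real.exp_log (hQp i)] using hεη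
  obtain ⟨h, C, a, b, hh, hmem, hs1, hs2⟩ := lattice_approx (fun i => Real.log (P2 ε i))
    (fun i => Real.log (Q2 ε i))
    (by simp only [Real.exp_log (hPp _), hP2s])
    (hle _ hPp hP2s) (hle _ hQp hQ2s)
    (by
      intro s hs
      have e := hform s (by linarith) (by linarith)
      have := mul_pos (mul_pos (by linarith : 0 < s) (by linarith : 0 < s - 1)) (hDc s)
      rw [e] at this; linarith)
    (by
      intro s hs hs'
      have e := hform s (by linarith) (by linarith)
      have := mul_pos (mul_pos (by linarith : 0 < s) (by linarith : 0 < 1 - s)) (hDc s)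
      linarith) _ (hgd.and (ev3.and ev4))
  obtain ⟨m1, m2, m3⟩ := hmem
  simp only at m1 m2 m3
  set P' : ι → ℝ := fun i => Real.exp (C - h * a i) with hP'
  set Q' : ι → ℝ := fun i => Real.exp (C - h * b i) with hQ'
  have hexp : ∀ k : ℕ, Real.exp (C - h * k) = Real.exp C * Real.exp (-h) ^ k := by
    intro k; rw [← Real.exp_nat_mul, ← Real.exp_add]; congr 1; ring
  obtain ⟨N, r, hr, hhr⟩ := poly_hinge a b (Real.exp (-h)) (Real.exp C) (Real.exp_pos _)
    (by rw [Real.exp_lt_one_iff]; linarith) (Real.exp_pos _) P' Q' (fun i => hexp _) (fun i => hexp _)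
    (hs1.trans hs2.symm) (m1 (hs1.trans hs2.symm))
  -- P majorizes P'
  have mP : Hinge P P' := by
    have hw : Hinge P (fun i => (P' i - (1 - ε) * P i) / ε) := by
      refine hinge_near_unif P _ η hP1 ?_ ?_ i0 ?_
      · rw [← Finset.sum_div, Finset.sum_sub_distrib, ← Finset.mul_sum, hP1, hs1]; field_simp; ring
      · intro i
        rw [← hn]
        have e : (P' i - (1 - ε) * P i) / ε - 1 / n = (P' i - P2 ε i) / ε := by
          simp only [P2]; field_simp; ring
        rw [e, abs_div, abs_of_pos hε, div_le_iff₀ hε, mul_comm]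
        exact (m2 i).le
      · rw [← hn]; have := h0 j0; nlinarith
    have := hinge_mix P P _ ε hε.le hε1.le (fun t _ => le_rfl) hw
    convert this using 2 with i
    field_simp; ring
  have mQ : Hinge Q' Q := by
    have hw : Hinge Q' (fun i => ((1 + ε) * Q i - Q' i) / ε) := by
      refine hinge_near_unif Q' _ η hs2 ?_ ?_ j0 ?_
      · rw [← Finset.sum_div, Finset.sum_sub_distrib, ← Finset.mul_sum, hQ1, hs2]; field_simp; ring
      · intro i
        rw [← hn]
        have e : ((1 + ε) * Q i - Q' i) / ε - 1 / n = -(Q' i - Q2 ε i) / ε := by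
          simp only [Q2]; field_simp; ring
        rw [e, abs_div, abs_neg, abs_of_pos hε, div_le_iff₀ hε, mul_comm]
        exact (m3 i).le
      · rw [← hn]
        have h3 := (abs_lt.1 (m3 j0)).1
        have h4 : Q j0 ≤ Q2 ε j0 := by simp only [Q2]; nlinarith
        have h5 : ε * η ≤ η := by nlinarith
        have h6 : Q j0 - η ≤ Q' j0 := by simp only [hQ']; linarith
        linarith
    have hε' : 0 < 1 + ε := by linarith
    have := hinge_mix Q' Q' _ (ε / (1 + ε)) (by positivity) (by rw [div_le_one hε']; linarith)
      (fun t _ => le_rfl) hw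
    convert this using 2 with i
    field_simp; ring
  exact ⟨N, r, hr, ((mP.kron' r hr.1).trans' (hhr.trans' (mQ.kron' r hr.1)))⟩

end Part6

section Part7
open scoped Topology
open Filter

/-- continuous extension of `(u^α - u)/(α - 1)` for `α ≥ 1`, `u ≥ 0` -/
noncomputable def hh (u α : ℝ) : ℝ :=
  ∫ s in (0:ℝ)..1, (1 / (1 + max s 0 * (max α 1 - 1))) *
    (u ^ (1 + max s 0 * (max α 1 - 1)) * Real.log (u ^ (1 + max s 0 * (max α 1 - 1))))

theorem hh_beta_pos (s α : ℝ) : 0 < 1 + max s 0 * (max α 1 - 1) := by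
  have h1 := le_max_right s 0
  have h2 := le_max_right α 1
  nlinarith [mul_nonneg h1 (sub_nonneg.2 h2)]

theorem hh_continuous : Continuous (fun z : ℝ × ℝ => hh z.1 z.2) := by
  unfold hh
  apply intervalIntegral.continuous_parametric_intervalIntegral_of_continuous'
  refine Continuous.mul ?_ ?_
  · exact Continuous.div (by fun_prop) (by fun_prop) (fun x => (hh_beta_pos _ _).ne')
  · refine Real.continuous_mul_log.comp (f := fun x : (ℝ × ℝ) × ℝ =>
      x.1.1 ^ (1 + max x.2 0 * (max x.1.2 1 - 1))) ?_
    exact Continuous.rpow (by fun_prop) (by fun_prop) (fun x => Or.inr (hh_beta_pos _ _))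

theorem hh_one (u : ℝ) : hh u 1 = u * Real.log u := by
  simp [hh]

theorem hh_formula {u α : ℝ} (hu : 0 ≤ u) (hα : 1 < α) : (α - 1) * hh u α = u ^ α - u := by
  rcases hu.eq_or_lt with h | h
  · subst h
    have : ∀ s : ℝ, (0:ℝ) ^ (1 + max s 0 * (max α 1 - 1)) = 0 := fun s =>
      Real.zero_rpow (hh_beta_pos _ _).ne'
    simp only [hh, this]
    rw [Real.zero_rpow (by linarith)]; simp
  · have hα' : α - 1 ≠ 0 := by linarith
    have key : hh u α = u ^ (1 + 1 * (α - 1)) / (α - 1) - u ^ (1 + 0 * (α - 1)) / (α - 1) := by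
      have e : hh u α = ∫ s in (0:ℝ)..1, u ^ (1 + s * (α - 1)) * Real.log u := by
        unfold hh
        refine intervalIntegral.integral_congr fun s hs => ?_
        rw [Set.uIcc_of_le zero_le_one] at hs
        have hb := hh_beta_pos s α
        rw [Real.log_rpow h]
        rw [max_eq_left hs.1, max_eq_left hα.le] at *
        field_simp
      rw [e]
      rw [intervalIntegral.integral_eq_sub_of_hasDerivAt
        (f := fun s => u ^ (1 + s * (α - 1)) / (α - 1))]
      · intro s _
        have h1 : HasDerivAt (fun s : ℝ => 1 + s * (α - 1)) (α - 1) s := by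
          simpa using ((hasDerivAt_id s).mul_const (α - 1)).const_add 1
        have := (h1.const_rpow h).div_const (α - 1)
        refine this.congr_deriv ?_
        rw [div_eq_iff hα']; ring
      · refine Continuous.intervalIntegrable ?_ _ _
        refine Continuous.mul (Continuous.rpow (by fun_prop) (by fun_prop) (fun x => Or.inl h.ne'))
          continuous_const
    rw [key]
    simp only [one_mul, zero_mul, add_zero, add_sub_cancel, Real.rpow_one]
    field_simp

theorem stepA {m : ℕ} (p q : Fin m → ℝ) (hp0 : ∀ i, 0 ≤ p i) (hp1 : ∑ i, p i = 1)
    (hq0 : ∀ i, 0 < q i) (hq1 : ∑ i, q i = 1) (i0 : Fin m) (h0 : ∀ j, q j < p i0)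
    (h1 : ∑ i, q i * Real.log (q i) < ∑ i, p i * Real.log (p i))
    (hgt : ∀ α : ℝ, 1 < α → ∑ i, q i ^ α < ∑ i, p i ^ α) (w0 : ℝ) (hw0 : 0 < w0) :
    ∃ a : ℝ, 0 < a ∧ a < 1 ∧ a < w0 ∧ (∀ i, 0 < q i - a / m) ∧
      (∀ j, q j - a / m < (1 - a) * ((1 - a) * p i0 + a / m)) ∧
      ∀ α : ℝ, 1 ≤ α → 0 < DD (fun i => (1 - a) * ((1 - a) * p i + a / m))
        (fun i => q i - a / m) α := by
  have hm : 0 < (m : ℝ) := Nat.cast_pos.2 (Nat.pos_of_ne_zero (by rintro rfl; exact i0.elim0))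
  obtain ⟨j0, -, hj0⟩ := Finset.exists_max_image Finset.univ q ⟨i0, Finset.mem_univ _⟩
  have hj0' : ∀ j, q j ≤ q j0 := fun j => hj0 j (Finset.mem_univ _)
  obtain ⟨θ, hθ1, hθ2⟩ := exists_between (h0 j0)
  have hθ : 0 < θ := (hq0 j0).trans hθ1
  obtain ⟨k, hk⟩ := pow_unbounded_of_one_lt (m : ℝ) ((one_lt_div (hq0 j0)).2 hθ1)
  set M : ℝ := k + 2 with hM
  let pa : ℝ → Fin m → ℝ := fun a i => (1 - a) * ((1 - a) * p i + a / m)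
  let qa : ℝ → Fin m → ℝ := fun a i => q i - a / m
  have hpa : ∀ i, Continuous (fun a => pa a i) := fun i => by simp only [pa]; fun_prop
  have hqa : ∀ i, Continuous (fun a => qa a i) := fun i => by simp only [qa]; fun_prop
  have hpa0 : ∀ i, pa 0 i = p i := fun i => by simp [pa]
  have hqa0 : ∀ i, qa 0 i = q i := fun i => by simp [qa]
  have evq : ∀ᶠ a in 𝓝 (0:ℝ), ∀ i, 0 < qa a i := by
    rw [eventually_all]; intro i
    exact (hqa i).continuousAt.eventually (lt_mem_nhds (by beta_reduce; rw [hqa0]; exact hq0 i))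
  have evp : ∀ᶠ a in 𝓝 (0:ℝ), θ < pa a i0 :=
    (hpa i0).continuousAt.eventually (lt_mem_nhds (by beta_reduce; rw [hpa0]; exact hθ2))
  have hcont : Continuous (fun z : ℝ × ℝ => ∑ i, hh (pa z.1 i) z.2 - ∑ i, hh (qa z.1 i) z.2) := by
    refine Continuous.sub (continuous_finsetSum _ fun i _ => ?_)
      (continuous_finsetSum _ fun i _ => ?_)
    · exact hh_continuous.comp (g := fun z : ℝ × ℝ => hh z.1 z.2)
        (f := fun z : ℝ × ℝ => (pa z.1 i, z.2)) (((hpa i).comp continuous_fst).prodMk continuous_snd)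
    · exact hh_continuous.comp (g := fun z : ℝ × ℝ => hh z.1 z.2)
        (f := fun z : ℝ × ℝ => (qa z.1 i, z.2)) (((hqa i).comp continuous_fst).prodMk continuous_snd)
  have evc : ∀ᶠ a in 𝓝 (0:ℝ), ∀ α ∈ Set.Icc 1 M,
      0 < ∑ i, hh (pa a i) α - ∑ i, hh (qa a i) α := by
    apply isCompact_Icc.eventually_forall_of_forall_eventually
    intro α hα
    refine hcont.continuousAt.eventually (lt_mem_nhds ?_)
    simp only [hpa0, hqa0]
    rcases hα.1.eq_or_lt with h | h
    · rw [← h]; simp only [hh_one]; linarith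
    · have h' : 0 < α - 1 := by linarith
      refine pos_of_mul_pos_right (a := α - 1) ?_ h'.le
      rw [mul_sub, Finset.mul_sum, Finset.mul_sum,
        Finset.sum_congr rfl fun i _ => hh_formula (hp0 i) h,
        Finset.sum_congr rfl fun i _ => hh_formula (hq0 i).le h,
        Finset.sum_sub_distrib, Finset.sum_sub_distrib, hp1, hq1]
      linarith [hgt α h]
  have hall := (eventually_mem_nhdsWithin (a := (0:ℝ)) (s := Set.Ioi 0)).and
    (((gt_mem_nhds (one_pos (α := ℝ))).and ((gt_mem_nhds hw0).and (evq.and (evp.and evc)))).filter_mono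
      nhdsWithin_le_nhds)
  obtain ⟨a, ha, ha1, haw, hq', hp', hc⟩ := hall.exists
  have ha : 0 < a := ha
  have ham : 0 < a / m := by positivity
  have hpapos : ∀ i, 0 < pa a i := fun i => by
    have := mul_nonneg (by linarith : 0 ≤ 1 - a) (hp0 i)
    exact mul_pos (by linarith) (by linarith)
  have hqle : ∀ i, qa a i ≤ q j0 := fun i => by
    have := hj0' i; simp only [qa]; linarith
  have hsum : ∑ i, pa a i = ∑ i, qa a i := by
    simp only [pa, qa]
    rw [← Finset.mul_sum, Finset.sum_add_distrib, ← Finset.mul_sum, Finset.sum_sub_distrib, hp1, hq1]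
    simp only [Finset.sum_const, Finset.card_univ, Fintype.card_fin, nsmul_eq_mul]
    field_simp; ring
  refine ⟨a, ha, ha1, haw, hq', fun j => lt_of_le_of_lt (hqle j) (hθ1.trans hp'), ?_⟩
  intro α hα
  change 0 < DD (pa a) (qa a) α
  rcases hα.eq_or_lt with h | h
  · have := hc 1 ⟨le_rfl, by rw [hM]; have : (0:ℝ) ≤ k := by positivity
                             linarith⟩
    simp only [hh_one] at this
    rw [← h, DD_one hpapos hq' hsum]; exact this
  have hpos : 0 < α * (α - 1) := mul_pos (by linarith) (by linarith)
  refine pos_of_mul_pos_right (a := α * (α - 1)) ?_ hpos.le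
  rw [DD_formula hpapos hq' hsum (by linarith) (by linarith)]
  by_cases hαM : α ≤ M
  · have := mul_pos (sub_pos.2 h) (hc α ⟨hα, hαM⟩)
    rw [mul_sub, Finset.mul_sum, Finset.mul_sum,
        Finset.sum_congr rfl fun i _ => hh_formula (hpapos i).le h,
        Finset.sum_congr rfl fun i _ => hh_formula (hq' i).le h,
        Finset.sum_sub_distrib, Finset.sum_sub_distrib, hsum] at this
    linarith
  · push Not at hαM
    have e1 : ∑ i, qa a i ^ α ≤ m * q j0 ^ α := by
      have : ∑ i : Fin m, qa a i ^ α ≤ ∑ i : Fin m, q j0 ^ α :=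
        Finset.sum_le_sum fun i _ => Real.rpow_le_rpow (hq' i).le (hqle i) (by linarith)
      simpa using this
    have e2 : (m : ℝ) ≤ (θ / q j0) ^ α := by
      refine hk.le.trans ?_
      rw [← Real.rpow_natCast]
      exact Real.rpow_le_rpow_of_exponent_le ((one_lt_div (hq0 j0)).2 hθ1).le (by linarith)
    have e3 : (θ / q j0) ^ α * q j0 ^ α = θ ^ α := by
      rw [← Real.mul_rpow (by have := hq0 j0; positivity) (hq0 j0).le, div_mul_cancel₀ _ (hq0 j0).ne']
    have e4 : θ ^ α < pa a i0 ^ α := Real.rpow_lt_rpow hθ.le hp' (by linarith)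
    have e5 : pa a i0 ^ α ≤ ∑ i, pa a i ^ α :=
      Finset.single_le_sum (f := fun i => pa a i ^ α) (fun i _ => (Real.rpow_pos_of_pos (hpapos i) _).le)
        (Finset.mem_univ i0)
    have e6 := mul_le_mul_of_nonneg_right e2 (Real.rpow_nonneg (hq0 j0).le α)
    linarith

end Part7

section Part8
open scoped Topology
open Filter

theorem AB_pos (A B : ℝ → ℝ) (hAc : Continuous A) (hBc : Continuous B)
    (hA : ∀ α, 1 ≤ α → 0 < A α) (hB : ∀ α, 0 < B α) (t w d M : ℝ) (ht : 0 < t) (ht1 : t ≤ 1)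
    (hw : 0 < w) (hM : 0 < M)
    (hA' : ∀ α, α < -M → -(d * w ^ α) ≤ α * (α - 1) * A α)
    (hB' : ∀ α, α < -M → 1 ≤ α * (α - 1) * B α) :
    ∀ᶠ n : ℕ in atTop, ∀ α, 0 < A α + n * (t / n) ^ α * B α := by
  obtain ⟨δ', hδ', hb⟩ := Metric.eventually_nhds_iff.1
    ((hAc.continuousAt (x := 1)).eventually (lt_mem_nhds (hA 1 le_rfl)))
  set δ := min (δ' / 2) (1 / 2) with hδ
  have hδpos : 0 < δ := lt_min (by linarith) (by norm_num)
  have hδ1 : δ ≤ δ' / 2 := min_le_left _ _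
  have hδ2 : δ ≤ 1 / 2 := min_le_right _ _
  have hA1 : ∀ α, 1 - δ ≤ α → 0 < A α := by
    intro α h
    rcases le_or_gt 1 α with h1 | h1
    · exact hA α h1
    · refine hb ?_
      rw [Real.dist_eq, abs_lt]; constructor <;> linarith
  have hne : (Set.Icc (-M) (1 - δ)).Nonempty := ⟨0, by linarith, by linarith⟩
  obtain ⟨α1, -, hα1⟩ := isCompact_Icc.exists_isMinOn hne hAc.continuousOn
  obtain ⟨α2, -, hα2⟩ := isCompact_Icc.exists_isMinOn hne hBc.continuousOn
  have hb2 := hB α2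
  have ev1 : ∀ᶠ n : ℕ in atTop, -A α1 / (t * B α2) < (n : ℝ) ^ δ :=
    ((tendsto_rpow_atTop hδpos).comp tendsto_natCast_atTop_atTop).eventually_gt_atTop _
  have ev2 : ∀ᶠ n : ℕ in atTop, max d (max 1 (t / w)) < (n : ℝ) :=
    (tendsto_natCast_atTop_atTop (R := ℝ)).eventually_gt_atTop _
  filter_upwards [ev1, ev2] with n h1 h2 α
  obtain ⟨hnd, h2⟩ := max_lt_iff.1 h2
  obtain ⟨hn1, hnt⟩ := max_lt_iff.1 h2
  have hn : (0:ℝ) < n := by linarith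
  have hc : 0 < (n : ℝ) * (t / n) ^ α := by positivity
  rcases le_or_gt (1 - δ) α with h | h
  · exact add_pos (hA1 α h) (mul_pos hc (hB α))
  rcases le_or_gt (-M) α with h' | h'
  · have a1 : A α1 ≤ A α := hα1 ⟨h', h.le⟩
    have a2 : B α2 ≤ B α := hα2 ⟨h', h.le⟩
    have e : (n : ℝ) * (t / n) ^ α = (n : ℝ) ^ (1 - α) * t ^ α := by
      rw [Real.div_rpow ht.le hn.le, Real.rpow_sub hn, Real.rpow_one]; ring
    have e1 : (n : ℝ) ^ δ ≤ (n : ℝ) ^ (1 - α) :=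
      Real.rpow_le_rpow_of_exponent_le hn1.le (by linarith)
    have e2 : t ≤ t ^ α := by
      conv_lhs => rw [← Real.rpow_one t]
      exact Real.rpow_le_rpow_of_exponent_ge ht ht1 (by linarith)
    rw [div_lt_iff₀ (by positivity)] at h1
    have e3 : (n : ℝ) ^ δ * t ≤ (n : ℝ) * (t / n) ^ α := by
      rw [e]; exact mul_le_mul e1 e2 ht.le (by positivity)
    have e4 := mul_le_mul e3 a2 hb2.le hc.le
    linarith
  · have hpos : 0 < α * (α - 1) := mul_pos_of_neg_of_neg (by linarith) (by linarith)
    refine pos_of_mul_pos_right (a := α * (α - 1)) ?_ hpos.le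
    have e1 : w ^ α ≤ (t / n) ^ α := by
      refine Real.rpow_le_rpow_of_nonpos (by positivity) ?_ (by linarith)
      rw [div_le_iff₀ hn]; rw [div_lt_iff₀ hw] at hnt; linarith
    have e2 := mul_le_mul_of_nonneg_left (hB' α h') hc.le
    have e3 := hA' α h'
    have hwα : 0 < w ^ α := by positivity
    have e4 := mul_le_mul_of_nonneg_left e1 hn.le
    have e5 := mul_lt_mul_of_pos_right hnd hwα
    have : α * (α - 1) * (A α + n * (t / n) ^ α * B α) =
      α * (α - 1) * A α + n * (t / n) ^ α * (α * (α - 1) * B α) := by ring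
    rw [this]; linarith

theorem qBext_zero {m : ℕ} (hm : (m : ℝ) ≠ 0) (a : ℝ) (n : ℕ) :
    qBext (fun _ : Fin m => a / m) n 0 = 1 - a := by
  simp [qBext]; field_simp

theorem qBext_succ {m : ℕ} (hm : (m : ℝ) ≠ 0) (a : ℝ) (n : ℕ) (j : Fin n) :
    qBext (fun _ : Fin m => a / m) n j.succ = a / n := by
  simp [qBext, Fin.succ_ne_zero]; field_simp

theorem qAB_zero {m : ℕ} (q a : Fin m → ℝ) (n : ℕ) (i : Fin m) :
    qAB q a n (i, 0) = q i - a i := by simp [qAB]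

theorem qAB_succ {m : ℕ} (q a : Fin m → ℝ) (n : ℕ) (i : Fin m) (j : Fin n) :
    qAB q a n (i, j.succ) = a i / n := by simp [qAB, Fin.succ_ne_zero]

theorem DD_split {m : ℕ} (pt q : Fin m → ℝ) (hpt : ∀ i, 0 < pt i) (hpt1 : ∑ i, pt i = 1)
    (a : ℝ) (ha : 0 < a) (n : ℕ) (hn : 0 < n) (hm : (0:ℝ) < m) (α : ℝ) :
    DD (kron pt (qBext (fun _ : Fin m => a / m) n)) (qAB q (fun _ => a / m) n) α =
      DD (fun i => (1 - a) * pt i) (fun i => q i - a / m) α +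
        n * (a / m / n) ^ α * ∑ i, kk (m * pt i) α := by
  have hn' : (0:ℝ) < n := Nat.cast_pos.2 hn
  have hs := kk_scale (fun i => m * pt i) (fun i => mul_pos hm (hpt i)) (by
    rw [Finset.sum_sub_distrib, ← Finset.mul_sum, hpt1]; simp) (c := a / m / n) (by positivity) α
  rw [mul_assoc, ← hs]
  unfold DD
  simp only [Fintype.sum_prod_type, Fin.sum_univ_succ, kron, qBext_zero hm.ne', qBext_succ hm.ne',
    qAB_zero, qAB_succ]
  simp only [Finset.sum_add_distrib, Finset.sum_sub_distrib, Finset.sum_const, Finset.card_univ,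
    Fintype.card_fin, nsmul_eq_mul, ← Finset.mul_sum]
  have e1 : ∀ i, a / m / n * (m * pt i) = pt i * (a / n) := fun i => by field_simp
  have e2 : ∀ i, pt i * (1 - a) = (1 - a) * pt i := fun i => mul_comm _ _
  simp only [e1, e2]
  ring

theorem stepC {m : ℕ} (pt q : Fin m → ℝ) (hpt : ∀ i, 0 < pt i) (hpt1 : ∑ i, pt i = 1)
    (hq1 : ∑ i, q i = 1) (a : ℝ) (ha : 0 < a) (ha1 : a < 1) (hqa : ∀ i, 0 < q i - a / m)
    (i0 : Fin m) (h0 : ∀ j, q j - a / m < (1 - a) * pt i0) (hi0 : 1 / (m : ℝ) < pt i0)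
    (hA : ∀ α : ℝ, 1 ≤ α → 0 < DD (fun i => (1 - a) * pt i) (fun i => q i - a / m) α) :
    ∀ᶠ n : ℕ in atTop, ∃ (K : ℕ) (r : Finset (Fin K) → ℝ), IsProbDist r ∧
      Hinge (kron (kron pt (qBext (fun _ : Fin m => a / m) n)) r)
        (kron (qAB q (fun _ => a / m) n) r) := by
  have hm' : 1 ≤ m := Nat.pos_of_ne_zero (by rintro rfl; exact i0.elim0)
  have hm1 : (1 : ℝ) ≤ m := by exact_mod_cast hm'
  have hm : (0 : ℝ) < m := by linarith
  obtain ⟨i1, -, hi1⟩ := Finset.exists_min_image Finset.univ pt ⟨i0, Finset.mem_univ _⟩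
  obtain ⟨j1, -, hj1⟩ := Finset.exists_min_image Finset.univ q ⟨i0, Finset.mem_univ _⟩
  have hμ : m * pt i1 < 1 := by
    have : ∑ i : Fin m, pt i1 < ∑ i, pt i := by
      by_contra hcon
      push Not at hcon
      have heq : ∀ i ∈ Finset.univ, pt i1 = pt i :=
        (Finset.sum_eq_sum_iff_of_le (fun i hi => hi1 i hi)).1
          (le_antisymm (Finset.sum_le_sum fun i hi => hi1 i hi) hcon)
      have h2 : ∑ i : Fin m, pt i0 = 1 := by
        rw [← hpt1]
        exact Finset.sum_congr rfl fun i hi => by rw [← heq i hi, ← heq i0 (Finset.mem_univ _)]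
      simp only [Finset.sum_const, Finset.card_univ, Fintype.card_fin, nsmul_eq_mul] at h2
      rw [div_lt_iff₀ hm] at hi0
      linarith
    rw [hpt1] at this
    simpa using this
  set w := q j1 - a / m with hw
  have hwpos : 0 < w := hqa j1
  have hwle : ∀ j, w ≤ q j - a / m := fun j => by have := hj1 j (Finset.mem_univ _); linarith
  have hkpos : ∀ i, 0 < m * pt i := fun i => mul_pos hm (hpt i)
  have hPpos : ∀ i, 0 < (1 - a) * pt i := fun i => mul_pos (by linarith) (hpt i)
  have hsumA : ∑ i, (1 - a) * pt i = ∑ i, (q i - a / m) := by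
    rw [← Finset.mul_sum, hpt1, Finset.sum_sub_distrib, hq1]
    simp; field_simp
  have hinv : 1 < (m * pt i1)⁻¹ := (one_lt_inv₀ (hkpos i1)).2 hμ
  obtain ⟨k, hk⟩ := pow_unbounded_of_one_lt ((m : ℝ) + 1) hinv
  have hev := AB_pos (DD (fun i => (1 - a) * pt i) (fun i => q i - a / m))
    (fun α => ∑ i, kk (m * pt i) α) (DD_cont_alpha hPpos hqa)
    (continuous_finsetSum _ fun i _ => kk_cont_alpha (hkpos i)) hA
    (fun α => Finset.sum_pos' (fun i _ => kk_nonneg (hkpos i) α)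
      ⟨i1, Finset.mem_univ _, kk_pos (hkpos i1) hμ.ne α⟩)
    (a / m) w m (k + 1) (by positivity) (by rw [div_le_one hm]; linarith) hwpos (by positivity)
    (by
      intro α hα
      have hk0 : (0:ℝ) ≤ k := by positivity
      rw [DD_formula hPpos hqa hsumA (by linarith) (by linarith)]
      have e1 : ∑ i, (q i - a / m) ^ α ≤ m * w ^ α := by
        have : ∑ i, (q i - a / m) ^ α ≤ ∑ i : Fin m, w ^ α :=
          Finset.sum_le_sum fun i _ => Real.rpow_le_rpow_of_nonpos hwpos (hwle i) (by linarith)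
        simpa using this
      have e2 : 0 ≤ ∑ i, ((1 - a) * pt i) ^ α :=
        Finset.sum_nonneg fun i _ => Real.rpow_nonneg (hPpos i).le _
      linarith)
    (by
      intro α hα
      have hk0 : (0:ℝ) ≤ k := by positivity
      have hα0 : α ≠ 0 := by linarith
      have hα1 : α ≠ 1 := by linarith
      beta_reduce
      rw [Finset.mul_sum, Finset.sum_congr rfl fun i _ => kk_formula (hkpos i) hα0 hα1,
        Finset.sum_sub_distrib, Finset.sum_sub_distrib, ← Finset.mul_sum, Finset.sum_sub_distrib,
        ← Finset.mul_sum, hpt1]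
      simp only [Finset.sum_const, Finset.card_univ, Fintype.card_fin, nsmul_eq_mul, mul_one,
        sub_self, mul_zero, sub_zero]
      have e1 : (m * pt i1) ^ α ≤ ∑ i, (m * pt i) ^ α :=
        Finset.single_le_sum (f := fun i => (m * pt i) ^ α)
          (fun i _ => Real.rpow_nonneg (hkpos i).le _) (Finset.mem_univ i1)
      have e2 : (m * pt i1)⁻¹ ^ k ≤ (m * pt i1) ^ α := by
        rw [← neg_neg α, Real.rpow_neg (hkpos i1).le, ← Real.inv_rpow (hkpos i1).le,
          ← Real.rpow_natCast]
        exact Real.rpow_le_rpow_of_exponent_le hinv.le (by linarith)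
      linarith)
  have ev2 : ∀ᶠ n : ℕ in atTop, max (max 1 (1 / w)) (a / m / w) < (n : ℝ) :=
    (tendsto_natCast_atTop_atTop (R := ℝ)).eventually_gt_atTop _
  filter_upwards [hev, ev2] with n hn1 hn2
  obtain ⟨hn3, hn4⟩ := max_lt_iff.1 hn2
  obtain ⟨hn3, hn5⟩ := max_lt_iff.1 hn3
  have hnpos : (0:ℝ) < n := by linarith
  have hn0 : 0 < n := by exact_mod_cast hnpos
  have hsmall : a / m / n < w := by
    rw [div_lt_iff₀ hnpos]; rw [div_lt_iff₀ hwpos] at hn4; linarith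
  have hsum2 : ∑ x, qAB q (fun _ => a / (m : ℝ)) n x = 1 := by
    simp only [Fintype.sum_prod_type, Fin.sum_univ_succ, qAB_zero, qAB_succ]
    simp only [Finset.sum_add_distrib, Finset.sum_sub_distrib, Finset.sum_const, Finset.card_univ,
      Fintype.card_fin, nsmul_eq_mul, hq1]
    field_simp; ring
  have hsum1 : ∑ x, kron pt (qBext (fun _ : Fin m => a / (m : ℝ)) n) x = 1 := by
    simp only [Fintype.sum_prod_type, Fin.sum_univ_succ, kron, qBext_zero hm.ne', qBext_succ hm.ne']
    simp only [Finset.sum_add_distrib, Finset.sum_const, Finset.card_univ,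
      Fintype.card_fin, nsmul_eq_mul, ← Finset.mul_sum, ← Finset.sum_mul, hpt1]
    field_simp; ring
  have hQlow : ∀ x, a / m / n ≤ qAB q (fun _ => a / (m : ℝ)) n x := by
    rintro ⟨i, j⟩
    refine Fin.cases ?_ (fun j => ?_) j
    · rw [qAB_zero]; exact hsmall.le.trans (hwle i)
    · rw [qAB_succ]
  have hpos' : 0 < a / m / n := by positivity
  refine trump_strict (kron pt (qBext (fun _ : Fin m => a / (m : ℝ)) n))
    (qAB q (fun _ => a / (m : ℝ)) n) ?_ (fun x => hpos'.trans_le (hQlow x)) hsum1 hsum2 (i0, 0)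
    (i1, Fin.succ ⟨0, hn0⟩) (j1, 0) ?_ ?_ ?_ ?_
  · rintro ⟨i, j⟩
    refine Fin.cases ?_ (fun j => ?_) j
    · simp only [kron, qBext_zero hm.ne']; exact mul_pos (hpt i) (by linarith)
    · simp only [kron, qBext_succ hm.ne']; have := hpt i; positivity
  · rintro ⟨i, j⟩
    simp only [kron, qBext_zero hm.ne']
    rw [mul_comm]
    refine Fin.cases ?_ (fun j => ?_) j
    · rw [qAB_zero]; exact h0 i
    · rw [qAB_succ]; exact hsmall.trans (h0 j1)
  · intro x
    refine lt_of_lt_of_le ?_ (hQlow x)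
    simp only [kron, qBext_succ hm.ne']
    rw [show a / m / n = (1 / m) * (a / n) by ring]
    refine mul_lt_mul_of_pos_right ?_ (by positivity)
    rw [lt_div_iff₀ hm]; linarith
  · rw [qAB_zero, Fintype.card_prod, Fintype.card_fin, Fintype.card_fin]
    push_cast
    rw [div_lt_iff₀ (by positivity)]
    rw [div_lt_iff₀ hwpos] at hn5
    change 1 < w * (m * (n + 1))
    have : (n : ℝ) ≤ m * (n + 1) := by nlinarith
    nlinarith
  · intro α
    rw [DD_split pt q hpt hpt1 a ha n hn0 hm]
    exact hn1 α

end Part8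

/-- **Lemma 2.** If `q` has full rank, is not uniform, and
`H_α(p) < H_α(q)` for all real `α ≥ 1` as well as for `α = ∞`, then there are
`a ∈ (0, m·min_i q_i)` and `N` such that, with `a_i := a/m`,
`p ⊗ q_B ≻_T q_{AB}` for all `n ≥ N`. -/
theorem lemma_part2 {m : ℕ} (p q : Fin m → ℝ)
    (hp : IsProbDist p) (hq : IsProbDist q)
    (hq_rank : ∀ i, q i ≠ 0) (hq_ne : q ≠ fun _ => 1 / (m : ℝ))
    (hα : ∀ α : ℝ, 1 ≤ α → renyi α p < renyi α q)
    (hinf : renyiInf p < renyiInf q) :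
    ∃ a : ℝ, 0 < a ∧ a < (m : ℝ) * (⨅ i, q i) ∧ ∃ N : ℕ, ∀ n ≥ N,
      Trumps (kron p (qBext (fun _ : Fin m => a / (m : ℝ)) n))
        (qAB q (fun _ => a / (m : ℝ)) n) := by
  have hm0 : m ≠ 0 := by
    rintro rfl
    have := hq.2
    simp at this
  have hne : Nonempty (Fin m) := ⟨⟨0, Nat.pos_of_ne_zero hm0⟩⟩
  have hm : (0:ℝ) < m := Nat.cast_pos.2 (Nat.pos_of_ne_zero hm0)
  have hq0 : ∀ i, 0 < q i := fun i => lt_of_le_of_ne (hq.1 i) (hq_rank i).symm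
  obtain ⟨i0, hi0⟩ := exists_eq_ciSup_of_finite (f := p)
  obtain ⟨j0, hj0⟩ := exists_eq_ciSup_of_finite (f := q)
  obtain ⟨j1, hj1⟩ := exists_eq_ciInf_of_finite (f := q)
  have hpos : ∀ r : Fin m → ℝ, IsProbDist r → ∃ i, 0 < r i := by
    intro r hr
    by_contra hcon
    push Not at hcon
    have : ∑ i, r i ≤ 0 := Finset.sum_nonpos fun i _ => hcon i
    rw [hr.2] at this; linarith
  obtain ⟨ip, hip⟩ := hpos p hp
  have hple : ∀ i, p i ≤ p i0 := fun i => by rw [hi0]; exact le_ciSup (Set.finite_range p).bddAbove i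
  have hqle : ∀ i, q i ≤ q j0 := fun i => by rw [hj0]; exact le_ciSup (Set.finite_range q).bddAbove i
  have hpi0 : 0 < p i0 := hip.trans_le (hple ip)
  have h0 : ∀ j, q j < p i0 := by
    intro j
    refine (hqle j).trans_lt ?_
    unfold renyiInf at hinf
    rw [← hi0, ← hj0] at hinf
    exact (Real.log_lt_log_iff (hq0 j0) hpi0).1 (by linarith)
  have h1 : ∑ i, q i * Real.log (q i) < ∑ i, p i * Real.log (p i) := by
    have := hα 1 le_rfl
    simp only [renyi, if_true, shannonEntropy] at this
    linarith
  have hgt : ∀ α : ℝ, 1 < α → ∑ i, q i ^ α < ∑ i, p i ^ α := by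
    intro α h
    have := hα α h.le
    have hps : 0 < ∑ i, p i ^ α := Finset.sum_pos' (fun i _ => Real.rpow_nonneg (hp.1 i) _)
      ⟨i0, Finset.mem_univ _, Real.rpow_pos_of_pos hpi0 _⟩
    have hqs : 0 < ∑ i, q i ^ α := Finset.sum_pos (fun i _ => Real.rpow_pos_of_pos (hq0 i) _)
      Finset.univ_nonempty
    simp only [renyi, if_neg h.ne', Real.sign_of_pos (by linarith : 0 < α)] at this
    refine (Real.log_lt_log_iff hqs hps).1 ?_
    have hneg : 1 / (1 - α) < 0 := one_div_neg.2 (by linarith)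
    exact lt_of_mul_lt_mul_of_nonpos_left this hneg.le
  have hi0m : 1 / (m : ℝ) < p i0 := by
    have : ∑ i, q i < ∑ i : Fin m, p i0 :=
      Finset.sum_lt_sum_of_nonempty Finset.univ_nonempty fun i _ => h0 i
    rw [hq.2] at this
    rw [div_lt_iff₀ hm]
    simp at this; linarith
  obtain ⟨a, ha, ha1, haw, hqa, hmax, hD⟩ := stepA p q hp.1 hp.2 hq0 hq.2 i0 h0 h1 hgt
    ((m : ℝ) * ⨅ i, q i) (by rw [← hj1]; exact mul_pos hm (hq0 j1))
  refine ⟨a, ha, haw, ?_⟩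
  have ham : 0 < a / m := by positivity
  have hC := stepC (fun i => (1 - a) * p i + a / m) q
    (fun i => by have := mul_nonneg (by linarith : 0 ≤ 1 - a) (hp.1 i); linarith)
    (by
      rw [Finset.sum_add_distrib, ← Finset.mul_sum, hp.2]
      simp; field_simp; ring) hq.2 a ha ha1 hqa i0 hmax
    (by
      have : a / m = a * (1 / m) := by ring
      rw [this]; nlinarith) hD
  obtain ⟨N, hN⟩ := Filter.eventually_atTop.1 hC
  refine ⟨N, fun n hn => ?_⟩
  obtain ⟨K, r, hr, hH⟩ := hN n hn
  have hB : ∀ j, 0 ≤ qBext (fun _ : Fin m => a / (m : ℝ)) n j := by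
    intro j
    refine Fin.cases ?_ (fun j => ?_) j
    · rw [qBext_zero hm.ne']; linarith
    · rw [qBext_succ hm.ne']; positivity
  have hmix : Hinge p (fun i => (1 - a) * p i + a / m) := by
    have hu : Hinge p (fun _ : Fin m => 1 / (m : ℝ)) := by
      refine hinge_near_unif p _ 0 hp.2 ?_ ?_ i0 ?_
      · simp [hm.ne']
      · simp
      · simp only [Fintype.card_fin, mul_zero]; linarith
    have := hinge_mix p p _ a ha.le ha1.le (fun t _ => le_rfl) hu
    convert this using 2 with i
    ring
  refine trumps_of_hinge (fun x => mul_nonneg (hp.1 _) (hB _)) ?_ r hr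
    (((hmix.kron' _ hB).kron' r hr.1).trans' hH)
  rintro ⟨i, j⟩
  refine Fin.cases ?_ (fun j => ?_) j
  · rw [qAB_zero]; exact (hqa i).le
  · rw [qAB_succ]; positivity
end

section
/- Let q ∈ ℝ^m be a probability distribution with full rank, and let 0 ≤ a ≤ b ≤ m·min_i q_i with b < 1. Then the probability distribution ((q_i − b/m)/(1 − b))_{i=1}^m majorizes the probability distribution ((q_i − a/m)/(1 − a))_{i=1}^m. Consequently, for every α ≥ 1, the map a ↦ H_α(((q_i − a/m)/(1 − a))_i) is decreasing on [0, m·min_i q_i] ∩ [0,1). -/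
open scoped BigOperators

/-- The shifted vector as a convex combination of the uniform one and the further shifted one. -/
theorem shift_comb (m : ℕ) (x a b : ℝ) (hab : a ≤ b) (hb1 : b < 1) :
    (x - a / (m : ℝ)) / (1 - a) =
      (1 - (1 - b) / (1 - a)) * (1 / (m : ℝ)) +
        ((1 - b) / (1 - a)) * ((x - b / (m : ℝ)) / (1 - b)) := by
  have h1 : 1 - a ≠ 0 := by linarith
  have h2 : 1 - b ≠ 0 := by linarith
  rw [div_eq_mul_inv a, div_eq_mul_inv b, one_div]
  field_simp
  ring

theorem shift_sum {m : ℕ} (hm : (m : ℝ) ≠ 0) (q : Fin m → ℝ) (hq : ∑ i, q i = 1) (t : ℝ)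
    (ht : t < 1) : ∑ i, (q i - t / (m : ℝ)) / (1 - t) = 1 := by
  have h2 : 1 - t ≠ 0 := by linarith
  rw [← Finset.sum_div, Finset.sum_sub_distrib, hq]
  simp only [Finset.sum_const, Finset.card_univ, Fintype.card_fin, nsmul_eq_mul]
  field_simp

theorem shift_nonneg {m : ℕ} (hm : 0 < (m : ℝ)) (q : Fin m → ℝ) (t : ℝ)
    (ht : t < 1) (htm : t ≤ (m : ℝ) * ⨅ i, q i) (i : Fin m) :
    0 ≤ (q i - t / (m : ℝ)) / (1 - t) := by
  have h : (⨅ i, q i) ≤ q i := ciInf_le (Set.finite_range q).bddBelow i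
  have h3 : t / (m : ℝ) ≤ ⨅ i, q i := by
    rw [div_le_iff₀ hm]; linarith
  exact div_nonneg (by linarith) (by linarith)

/-- Convex sums increase along the shift. -/
theorem shift_convex {m : ℕ} (hm : 0 < (m : ℝ)) (q : Fin m → ℝ) (hq : ∑ i, q i = 1)
    (a b : ℝ) (hab : a ≤ b) (hb : b ≤ (m : ℝ) * ⨅ i, q i) (hb1 : b < 1)
    (f : ℝ → ℝ) (hf : ConvexOn ℝ (Set.Ici 0) f) :
    ∑ i, f ((q i - a / (m : ℝ)) / (1 - a)) ≤ ∑ i, f ((q i - b / (m : ℝ)) / (1 - b)) := by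
  have hl0 : 0 ≤ (1 - b) / (1 - a) := div_nonneg (by linarith) (by linarith)
  have hl1 : (1 - b) / (1 - a) ≤ 1 := by rw [div_le_one (by linarith)]; linarith
  have hc := fun i => shift_comb m (q i) a b hab hb1
  have hs := shift_sum hm.ne' q hq b hb1
  have hn := shift_nonneg hm q b hb1 hb
  generalize (1 - b) / (1 - a) = l at *
  simp only [hc]
  clear hc
  generalize hr : (fun i => (q i - b / (m : ℝ)) / (1 - b)) = r at *
  have hr' : ∀ i, (q i - b / (m : ℝ)) / (1 - b) = r i := fun i => congrFun hr i
  simp only [hr'] at *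
  have hJ : f (1 / m) ≤ ∑ i, (1 / (m : ℝ)) * f (r i) := by
    have := hf.map_sum_le (t := Finset.univ) (w := fun _ : Fin m => 1 / (m : ℝ)) (p := r)
      (fun i _ => by positivity) (by simp [hm.ne']) (fun i _ => hn i)
    simpa [← Finset.mul_sum, hs] using this
  rw [← Finset.mul_sum] at hJ
  have hJ' : m * f (1 / m) ≤ ∑ i, f (r i) := by
    calc m * f (1 / m) ≤ m * (1 / (m : ℝ) * ∑ i, f (r i)) := by gcongr
      _ = _ := by field_simp
  calc ∑ i, f ((1 - l) * (1 / (m : ℝ)) + l * r i)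
      ≤ ∑ i, ((1 - l) * f (1 / (m : ℝ)) + l * f (r i)) := by
        refine Finset.sum_le_sum fun i _ => ?_
        exact hf.2 (by simp : (1 / (m : ℝ)) ∈ Set.Ici 0) (hn i) (by linarith) hl0 (by ring)
    _ = (1 - l) * (m * f (1 / m)) + l * ∑ i, f (r i) := by
        rw [Finset.sum_add_distrib, ← Finset.mul_sum, ← Finset.mul_sum]
        simp
    _ ≤ (1 - l) * (∑ i, f (r i)) + l * ∑ i, f (r i) := by
        have : 0 ≤ 1 - l := by linarith
        gcongr
    _ = _ := by ring

/-- Some cyclic shift of `A` has at least the average weight. -/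
theorem exists_avg {m : ℕ} (hm : 0 < (m : ℝ)) (r : Fin m → ℝ) (hr : ∑ i, r i = 1)
    (A : Finset (Fin m)) :
    ∃ B : Finset (Fin m), B.card = A.card ∧ (A.card : ℝ) * (1 / m) ≤ ∑ i ∈ B, r i := by
  have hm0 : m ≠ 0 := by rintro rfl; simp at hm
  have : NeZero m := ⟨hm0⟩
  have h : ∑ c : Fin m, (A.card : ℝ) * (1 / m) ≤ ∑ c : Fin m, ∑ i ∈ A, r (i + c) := by
    rw [Finset.sum_comm]
    have : ∀ i : Fin m, ∑ c, r (i + c) = 1 := fun i => by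
      rw [← hr]; exact Equiv.sum_comp (Equiv.addLeft i) r
    simp only [this]
    simp
    field_simp
    rfl
  obtain ⟨c, -, hc⟩ := Finset.exists_le_of_sum_le ⟨0, Finset.mem_univ _⟩ h
  refine ⟨A.map (Equiv.addRight c).toEmbedding, by simp, ?_⟩
  simpa using hc

/-- For a full-rank distribution `q` and `0 ≤ a ≤ b ≤ m·min_i q_i`,
`b < 1`, the distribution `((q_i - b/m)/(1-b))_i` majorizes `((q_i - a/m)/(1-a))_i`;
consequently `a ↦ H_α(((q_i - a/m)/(1-a))_i)` is decreasing for every `α ≥ 1`. -/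
theorem shifted_majorization {m : ℕ} (q : Fin m → ℝ) (hq : IsProbDist q)
    (hq_rank : ∀ i, q i ≠ 0) (a b : ℝ) (ha : 0 ≤ a) (hab : a ≤ b)
    (hb : b ≤ (m : ℝ) * ⨅ i, q i) (hb1 : b < 1) :
    Majorizes (fun i => (q i - b / (m : ℝ)) / (1 - b))
      (fun i => (q i - a / (m : ℝ)) / (1 - a)) ∧
    ∀ α : ℝ, 1 ≤ α →
      AntitoneOn (fun t : ℝ => renyi α fun i => (q i - t / (m : ℝ)) / (1 - t))
        (Set.Icc 0 ((m : ℝ) * ⨅ i, q i) ∩ Set.Iio 1) := by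
  obtain ⟨-, hq1⟩ := hq
  have hm : 0 < (m : ℝ) := by
    rcases Nat.eq_zero_or_pos m with rfl | h
    · simp at hq1
    · exact_mod_cast h
  constructor
  · intro A
    have hl0 : 0 ≤ (1 - b) / (1 - a) := div_nonneg (by linarith) (by linarith)
    have hl1 : (1 - b) / (1 - a) ≤ 1 := by rw [div_le_one (by linarith)]; linarith
    have hs := shift_sum hm.ne' q hq1 b hb1
    simp only [fun i => shift_comb m (q i) a b hab hb1]
    rw [Finset.sum_add_distrib, ← Finset.mul_sum, ← Finset.mul_sum, Finset.sum_const, nsmul_eq_mul]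
    generalize (1 - b) / (1 - a) = l at *
    rcases le_total ((A.card : ℝ) * (1 / m)) (∑ i ∈ A, (q i - b / (m : ℝ)) / (1 - b)) with h | h
    · refine ⟨A, le_rfl, ?_⟩
      nlinarith
    · obtain ⟨B, hB, hB'⟩ := exists_avg hm _ hs A
      refine ⟨B, hB.le, ?_⟩
      nlinarith
  · rintro α hα s ⟨⟨hs0, hsm⟩, hs1⟩ t ⟨⟨ht0, htm⟩, ht1⟩ hst
    simp only [Set.mem_Iio] at hs1 ht1
    have key := shift_convex hm q hq1 s t hst htm ht1
    by_cases h1 : α = 1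
    · simp only [renyi, h1, if_true, shannonEntropy]
      exact neg_le_neg (key _ Real.convexOn_mul_log)
    · have hα1 : 1 < α := lt_of_le_of_ne hα (Ne.symm h1)
      simp only [renyi, h1, if_false]
      rw [Real.sign_of_pos (by linarith)]
      have hk := key _ (convexOn_rpow hα)
      have hpos : 0 < ∑ i, ((q i - s / (m : ℝ)) / (1 - s)) ^ α := by
        have hn := shift_nonneg hm q s hs1 hsm
        have hsum := shift_sum hm.ne' q hq1 s hs1
        obtain ⟨i, hi, hi'⟩ := Finset.exists_ne_zero_of_sum_ne_zero (by rw [hsum]; exact one_ne_zero)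
        exact Finset.sum_pos' (fun j _ => Real.rpow_nonneg (hn j) α)
          ⟨i, hi, Real.rpow_pos_of_pos (lt_of_le_of_ne (hn i) hi'.symm) α⟩
      have hlog := Real.log_le_log hpos hk
      exact mul_le_mul_of_nonpos_left hlog
        (div_nonpos_of_nonneg_of_nonpos zero_le_one (by linarith))
end

section
/- Let S : Δ⁺ → ℝ be continuous, symmetric, additive, and subadditive. For p ∈ Δ_m⁺ define I(p) := log m − H(p) and J(p) := S(η_m) − S(p). Then for all p ∈ Δ_m⁺ and q ∈ Δ_n⁺ (any m, n ∈ ℕ), I(p) ≥ I(q) implies J(p) ≥ J(q). -/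
open scoped BigOperators

/-- `S` extended to arbitrary finite types. -/
noncomputable def SF (S : ∀ n : ℕ, (Fin n → ℝ) → ℝ) (ι : Type) [Fintype ι] (p : ι → ℝ) : ℝ :=
  S (Fintype.card ι) (p ∘ (Fintype.equivFin ι).symm)

lemma IsPosProbDist.comp_equiv {ι κ : Type} [Fintype ι] [Fintype κ] {p : κ → ℝ}
    (hp : IsPosProbDist p) (e : ι ≃ κ) : IsPosProbDist (p ∘ e) :=
  ⟨fun i => hp.1 _, by rw [← hp.2]; exact Equiv.sum_comp e p⟩

lemma IsPosProbDist.kron' {ι κ : Type} [Fintype ι] [Fintype κ] {p : ι → ℝ} {q : κ → ℝ}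
    (hp : IsPosProbDist p) (hq : IsPosProbDist q) : IsPosProbDist (kron p q) :=
  ⟨fun i => mul_pos (hp.1 _) (hq.1 _), by
    simp only [kron, Fintype.sum_prod_type, ← Finset.mul_sum, hq.2, mul_one, hp.2]⟩

lemma IsPosProbDist.nonempty' {ι : Type} [Fintype ι] {p : ι → ℝ}
    (hp : IsPosProbDist p) : Nonempty ι := by
  by_contra h
  rw [not_nonempty_iff] at h
  have := hp.2
  simp at this

lemma SF_eq {S : ∀ n : ℕ, (Fin n → ℝ) → ℝ} (hsym : SymmetricS S) {ι : Type} [Fintype ι]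
    {m : ℕ} (e : ι ≃ Fin m) {p : ι → ℝ} (hp : IsPosProbDist p) :
    SF S ι p = S m (p ∘ e.symm) := by
  obtain rfl : Fintype.card ι = m := by simpa using Fintype.card_congr e
  have := hsym _ (p ∘ e.symm) (hp.comp_equiv e.symm) ((Fintype.equivFin ι).symm.trans e)
  rw [← this]
  unfold SF
  congr 1
  ext i
  simp

lemma SF_equiv {S : ∀ n : ℕ, (Fin n → ℝ) → ℝ} (hsym : SymmetricS S) {ι κ : Type} [Fintype ι]
    [Fintype κ] (e : ι ≃ κ) {p : κ → ℝ} (hp : IsPosProbDist p) :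
    SF S ι (p ∘ e) = SF S κ p := by
  rw [SF_eq hsym (e.trans (Fintype.equivFin κ)) (hp.comp_equiv e)]
  unfold SF
  congr 1
  ext i
  simp

lemma SF_kron {S : ∀ n : ℕ, (Fin n → ℝ) → ℝ} (hsym : SymmetricS S) (hadd : AdditiveS S)
    {ι κ : Type} [Fintype ι] [Fintype κ] {p : ι → ℝ} {q : κ → ℝ}
    (hp : IsPosProbDist p) (hq : IsPosProbDist q) :
    SF S (ι × κ) (kron p q) = SF S ι p + SF S κ q := by
  rw [SF_eq hsym (((Fintype.equivFin ι).prodCongr (Fintype.equivFin κ)).trans finProdFinEquiv)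
    (hp.kron' hq)]
  have := hadd _ _ _ _ (hp.comp_equiv (Fintype.equivFin ι).symm)
    (hq.comp_equiv (Fintype.equivFin κ).symm)
  unfold SF
  rw [← this]
  rfl

lemma IsPosProbDist.margA {ι κ : Type} [Fintype ι] [Fintype κ] {P : ι × κ → ℝ}
    (hP : IsPosProbDist P) : IsPosProbDist (fun i => ∑ j, P (i, j)) := by
  have : Nonempty κ := hP.nonempty'.map Prod.snd
  exact ⟨fun i => Finset.sum_pos (fun j _ => hP.1 _) Finset.univ_nonempty, by
    rw [← hP.2, Fintype.sum_prod_type]⟩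

lemma IsPosProbDist.margB {ι κ : Type} [Fintype ι] [Fintype κ] {P : ι × κ → ℝ}
    (hP : IsPosProbDist P) : IsPosProbDist (fun j => ∑ i, P (i, j)) := by
  have : Nonempty ι := hP.nonempty'.map Prod.fst
  exact ⟨fun i => Finset.sum_pos (fun j _ => hP.1 _) Finset.univ_nonempty, by
    rw [← hP.2, Fintype.sum_prod_type_right]⟩

lemma SF_sub {S : ∀ n : ℕ, (Fin n → ℝ) → ℝ} (hsym : SymmetricS S) (hadd : AdditiveS S)
    (hsub : SubadditiveS S)
    {ι κ : Type} [Fintype ι] [Fintype κ] {P : ι × κ → ℝ} (hP : IsPosProbDist P) :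
    SF S (ι × κ) P ≤ SF S ι (fun i => ∑ j, P (i, j)) + SF S κ (fun j => ∑ i, P (i, j)) := by
  set e := (Fintype.equivFin ι).prodCongr (Fintype.equivFin κ)
  rw [SF_eq hsym (e.trans finProdFinEquiv) hP]
  have h := hsub _ _ (P ∘ e.symm) (hP.comp_equiv e.symm)
  refine h.trans (le_of_eq ?_)
  rw [← SF_kron hsym hadd hP.margA hP.margB,
    SF_eq hsym (e.trans finProdFinEquiv) (hP.margA.kron' hP.margB)]
  congr 1
  ext x
  simp only [kron, Function.comp]
  congr 1
  · exact Equiv.sum_comp (Fintype.equivFin κ).symm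
      (fun j => P ((Fintype.equivFin ι).symm (finProdFinEquiv.symm x).1, j))
  · exact Equiv.sum_comp (Fintype.equivFin ι).symm
      (fun i => P (i, (Fintype.equivFin κ).symm (finProdFinEquiv.symm x).2))

/-- The `n`-fold tensor power. -/
noncomputable def tpow {α : Type} (p : α → ℝ) (n : ℕ) : (Fin n → α) → ℝ := fun x => ∏ i, p (x i)

lemma sum_fin_succ {α : Type} [Fintype α] {n : ℕ} (F : (Fin (n + 1) → α) → ℝ) :
    ∑ x, F x = ∑ a, ∑ y : Fin n → α, F (Fin.cons a y) := by
  rw [← Fintype.sum_prod_type' (f := fun a y => F (Fin.cons a y))]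
  exact (Equiv.sum_comp (Fin.consEquiv (fun _ : Fin (n + 1) => α)) F).symm

lemma tpow_cons {α : Type} (p : α → ℝ) (n : ℕ) (a : α) (y : Fin n → α) :
    tpow p (n + 1) (Fin.cons a y) = p a * tpow p n y := by
  simp [tpow, Fin.prod_univ_succ]

lemma tpow_pos {α : Type} [Fintype α] {p : α → ℝ} (hp : IsPosProbDist p) (n : ℕ) :
    IsPosProbDist (tpow p n) := by
  refine ⟨fun x => Finset.prod_pos fun i _ => hp.1 _, ?_⟩
  induction n with
  | zero => simp [tpow]
  | succ n ih =>
    rw [sum_fin_succ]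
    simp only [tpow_cons, ← Finset.mul_sum, ih, mul_one, hp.2]

lemma SF_unique {S : ∀ n : ℕ, (Fin n → ℝ) → ℝ} (hsym : SymmetricS S) (hadd : AdditiveS S)
    {ι : Type} [Fintype ι] [Unique ι] {p : ι → ℝ} (hp : IsPosProbDist p) : SF S ι p = 0 := by
  have h := SF_kron hsym hadd hp hp
  have h2 := SF_equiv hsym (Equiv.prodUnique ι ι) hp
  have h3 : p ∘ (Equiv.prodUnique ι ι) = kron p p := by
    have h1 : p default = 1 := by simpa using hp.2
    ext x
    rcases x with ⟨a, b⟩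
    rw [Unique.eq_default a, Unique.eq_default b]
    simp [kron, h1]
  rw [h3] at h2
  linarith

lemma SF_tpow {S : ∀ n : ℕ, (Fin n → ℝ) → ℝ} (hsym : SymmetricS S) (hadd : AdditiveS S)
    {α : Type} [Fintype α] {p : α → ℝ} (hp : IsPosProbDist p) (n : ℕ) :
    SF S (Fin n → α) (tpow p n) = n * SF S α p := by
  induction n with
  | zero => simpa using SF_unique hsym hadd (tpow_pos hp 0)
  | succ n ih =>
    rw [← SF_equiv hsym (Fin.consEquiv (fun _ : Fin (n + 1) => α)) (tpow_pos hp (n+1))]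
    have : tpow p (n+1) ∘ (Fin.consEquiv (fun _ : Fin (n + 1) => α)) = kron p (tpow p n) := by
      ext x
      exact tpow_cons p n x.1 x.2
    rw [this, SF_kron hsym hadd hp (tpow_pos hp n), ih]
    push_cast; ring

open Classical in
/-- Indicator function. -/
noncomputable def ind {α : Type} (a b : α) : ℝ := if b = a then 1 else 0

lemma ind_sum {α : Type} [Fintype α] (p : α → ℝ) (a : α) : ∑ b, p b * ind a b = p a := by
  rw [Fintype.sum_eq_single a]
  · simp [ind]
  · intro b hb
    simp [ind, hb]

lemma ind_sum' {α : Type} [Fintype α] (b : α) : ∑ a, ind a b = 1 := by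
  rw [Fintype.sum_eq_single b]
  · simp [ind]
  · intro a ha
    simp [ind, ha.symm]

lemma ind_nonneg {α : Type} (a b : α) : 0 ≤ ind a b := by
  unfold ind; split_ifs <;> norm_num

lemma ind_le_one {α : Type} (a b : α) : ind a b ≤ 1 := by
  unfold ind; split_ifs <;> norm_num

/-- Marginal on coordinate `i`. -/
noncomputable def marg {α : Type} [Fintype α] {n : ℕ} (P : (Fin n → α) → ℝ) (i : Fin n) : α → ℝ :=
  fun a => ∑ x, P x * ind a (x i)

lemma SF_marg {S : ∀ n : ℕ, (Fin n → ℝ) → ℝ} (hsym : SymmetricS S) (hadd : AdditiveS S)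
    (hsub : SubadditiveS S) {α : Type} [Fintype α] (n : ℕ) (P : (Fin n → α) → ℝ)
    (hP : IsPosProbDist P) : SF S (Fin n → α) P ≤ ∑ i, SF S α (marg P i) := by
  induction n with
  | zero => simpa using (SF_unique hsym hadd hP).le
  | succ n ih =>
    rw [← SF_equiv hsym (Fin.consEquiv (fun _ : Fin (n + 1) => α)) hP]
    have hP' := hP.comp_equiv (Fin.consEquiv (fun _ : Fin (n + 1) => α))
    refine (SF_sub hsym hadd hsub hP').trans ?_
    rw [Fin.sum_univ_succ]
    refine add_le_add (le_of_eq ?_) ((ih _ hP'.margB).trans (le_of_eq ?_))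
    · congr 1
      ext a
      have h0 : ∀ (x : α) (y : Fin n → α), (Fin.cons x y : Fin (n + 1) → α) 0 = x :=
        fun _ _ => rfl
      simp only [marg, sum_fin_succ, h0, ← Finset.sum_mul]
      exact (ind_sum (fun x => ∑ y : Fin n → α, P (Fin.cons x y)) a).symm
    · refine Finset.sum_congr rfl fun i _ => ?_
      congr 1
      ext a
      have h0 : ∀ (x : α) (y : Fin n → α), (Fin.cons x y : Fin (n + 1) → α) i.succ = y i :=
        fun _ _ => rfl
      simp only [marg, sum_fin_succ, h0]
      rw [Finset.sum_comm]
      simp only [← Finset.sum_mul]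
      rfl

lemma unif_pos {κ : Type} [Fintype κ] [Nonempty κ] :
    IsPosProbDist (fun _ : κ => 1 / (Fintype.card κ : ℝ)) := by
  have : (0:ℝ) < Fintype.card κ := by exact_mod_cast Fintype.card_pos
  exact ⟨fun _ => by positivity, by simp⟩

/-- Mixing permutations increases `S`. -/
lemma SF_mix {S : ∀ n : ℕ, (Fin n → ℝ) → ℝ} (hsym : SymmetricS S) (hadd : AdditiveS S)
    (hsub : SubadditiveS S) {ι κ : Type} [Fintype ι] [Fintype κ] [Nonempty κ]
    {P : ι → ℝ} (hP : IsPosProbDist P) (σ : κ → Equiv.Perm ι) :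
    SF S ι P ≤ SF S ι (fun x => ∑ k, P (σ k x) * (1 / (Fintype.card κ : ℝ))) := by
  let e : ι × κ ≃ ι × κ :=
    { toFun := fun x => (σ x.2 x.1, x.2)
      invFun := fun x => ((σ x.2).symm x.1, x.2)
      left_inv := fun x => by simp
      right_inv := fun x => by simp }
  have hk := hP.kron' (unif_pos (κ := κ))
  have h := SF_sub hsym hadd hsub (hk.comp_equiv e)
  rw [SF_equiv hsym e hk, SF_kron hsym hadd hP unif_pos] at h
  have h2 : (fun j => ∑ i, (kron P (fun _ : κ => 1 / (Fintype.card κ : ℝ)) ∘ e) (i, j)) =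
      (fun _ : κ => 1 / (Fintype.card κ : ℝ)) := by
    ext j
    simp only [Function.comp, kron, e, Equiv.coe_fn_mk, ← Finset.sum_mul]
    rw [Equiv.sum_comp (σ j) P, hP.2, one_mul]
  rw [h2] at h
  exact le_of_add_le_add_right h

/-- Variance of a sum of i.i.d. centered variables. -/
lemma var_sum {α : Type} [Fintype α] {p : α → ℝ} (hp : IsPosProbDist p) (g : α → ℝ)
    (hg : ∑ a, p a * g a = 0) (n : ℕ) :
    ∑ x, tpow p n x * (∑ i, g (x i)) ^ 2 = n * ∑ a, p a * g a ^ 2 := by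
  induction n with
  | zero => simp
  | succ n ih =>
    rw [sum_fin_succ]
    have h1 := (tpow_pos hp n).2
    have : ∀ a, ∑ y : Fin n → α, tpow p (n+1) (Fin.cons a y) *
        (∑ i, g ((Fin.cons a y : Fin (n+1) → α) i)) ^ 2 =
        p a * g a ^ 2 + (p a * g a) * (2 * ∑ y, tpow p n y * ∑ i, g (y i))
          + p a * (n * ∑ a, p a * g a ^ 2) := by
      intro a
      rw [← ih]
      have : p a * g a ^ 2 = p a * g a ^ 2 * ∑ y, tpow p n y := by rw [h1, mul_one]
      rw [this]
      simp only [Finset.mul_sum (s := (Finset.univ : Finset (Fin n → α))),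
        ← Finset.sum_add_distrib]
      refine Finset.sum_congr rfl fun y _ => ?_
      rw [tpow_cons, Fin.sum_univ_succ]
      simp only [Fin.cons_zero, Fin.cons_succ]
      ring
    simp only [this]
    rw [Finset.sum_add_distrib, Finset.sum_add_distrib, ← Finset.sum_mul, ← Finset.sum_mul, hg, hp.2]
    push_cast; ring

open Classical in
lemma concentration {α κ : Type} [Fintype α] [Fintype κ] {p : α → ℝ} (hp : IsPosProbDist p)
    (g : κ → α → ℝ) (hg : ∀ k, ∑ a, p a * g k a = 0) {δ ε : ℝ} (hδ : 0 < δ) (hε : 0 < ε) :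
    ∀ᶠ n : ℕ in Filter.atTop,
      ∑ x ∈ Finset.univ.filter (fun x : Fin n → α => ¬ ∀ k, |∑ i, g k (x i)| ≤ n * δ),
        tpow p n x ≤ ε := by
  set V := ∑ k, ∑ a, p a * g k a ^ 2 with hV
  have hlim : ∀ᶠ n : ℕ in Filter.atTop, V / (ε * δ ^ 2) ≤ n :=
    (tendsto_natCast_atTop_atTop (R := ℝ)).eventually_ge_atTop _
  filter_upwards [hlim, Filter.eventually_gt_atTop 0] with n hn hn0
  have hn0' : (0:ℝ) < n := by exact_mod_cast hn0
  have hpos := (tpow_pos hp n).1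
  have key : ∑ x ∈ Finset.univ.filter (fun x : Fin n → α => ¬ ∀ k, |∑ i, g k (x i)| ≤ n * δ),
        tpow p n x ≤ ∑ x, tpow p n x * ((∑ k, (∑ i, g k (x i)) ^ 2) / (n * δ) ^ 2) := by
    rw [Finset.sum_filter]
    refine Finset.sum_le_sum fun x _ => ?_
    have h0 : 0 ≤ (∑ k, (∑ i, g k (x i)) ^ 2) := Finset.sum_nonneg fun k _ => sq_nonneg _
    by_cases h : ¬ ∀ k, |∑ i, g k (x i)| ≤ n * δ
    · rw [if_pos h]
      push Not at h
      obtain ⟨k, hk⟩ := h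
      refine le_mul_of_one_le_right (hpos x).le ?_
      rw [one_le_div (by positivity)]
      calc (n * δ) ^ 2 ≤ (∑ i, g k (x i)) ^ 2 := by
            rw [← sq_abs (∑ i, g k (x i))]
            gcongr
        _ ≤ _ := Finset.single_le_sum (f := fun k => (∑ i, g k (x i)) ^ 2)
            (fun k _ => sq_nonneg _) (Finset.mem_univ k)
    · rw [if_neg h]
      have := (hpos x).le
      positivity
  refine key.trans ?_
  have : ∑ x, tpow p n x * ((∑ k, (∑ i, g k (x i)) ^ 2) / (n * δ) ^ 2) = n * V / (n * δ) ^ 2 := by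
    simp only [← mul_div_assoc, ← Finset.sum_div, Finset.mul_sum, hV]
    rw [Finset.sum_comm]
    congr 1
    refine Finset.sum_congr rfl fun k _ => ?_
    rw [← Finset.mul_sum]
    exact var_sum hp (g k) (hg k) n
  rw [this, div_le_iff₀ (by positivity)]
  rw [div_le_iff₀ (by positivity)] at hn
  nlinarith

lemma tpow_eq_exp {α : Type} [Fintype α] {p : α → ℝ} (hp : IsPosProbDist p) {n : ℕ}
    (x : Fin n → α) : tpow p n x =
      Real.exp (∑ i, (Real.log (p (x i)) + shannonEntropy p) - n * shannonEntropy p) := by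
  rw [Finset.sum_add_distrib]
  simp only [Finset.sum_const, Finset.card_univ, Fintype.card_fin, nsmul_eq_mul, add_sub_cancel_right]
  rw [Real.exp_sum]
  exact Finset.prod_congr rfl fun i _ => (Real.exp_log (hp.1 _)).symm

lemma log_centered {α : Type} [Fintype α] {p : α → ℝ} (hp : IsPosProbDist p) :
    ∑ a, p a * (Real.log (p a) + shannonEntropy p) = 0 := by
  simp only [mul_add, Finset.sum_add_distrib, ← Finset.sum_mul, hp.2, shannonEntropy]
  ring

open Classical in
lemma exists_perm {X : Type} [Fintype X] (A T : Finset X) (h : A.card ≤ T.card) :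
    ∃ π : Equiv.Perm X, ∀ x ∈ A, π x ∈ T := by
  obtain ⟨T', hT', hc⟩ := Finset.exists_subset_card_eq h
  let e : {x // x ∈ A} ≃ {x // x ∈ T'} := Fintype.equivOfCardEq (by simp [hc])
  exact ⟨e.extendSubtype, fun x hx => hT' (e.extendSubtype_mem x hx)⟩

open Classical in
/-- Typicality: for large `n` there is a permutation of the sequences sending most of the mass of
`p ^ n` to sequences whose empirical distribution is close to `q`. -/
lemma exists_good_perm {α : Type} [Fintype α] {p q : α → ℝ} (hp : IsPosProbDist p)
    (hq : IsPosProbDist q) (hH : shannonEntropy p < shannonEntropy q) {δ : ℝ} (hδ : 0 < δ) :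
    ∃ n : ℕ, 0 < n ∧ ∃ (π : Equiv.Perm (Fin n → α)) (A : Finset (Fin n → α)),
      (∑ x ∈ Aᶜ, tpow p n x ≤ δ) ∧
      ∀ x ∈ A, ∀ a, |∑ i, (ind a (π x i) - q a)| ≤ n * δ := by
  set γ := shannonEntropy q - shannonEntropy p with hγ
  have hγ0 : 0 < γ := by linarith
  set δ' := min δ (γ / 4) with hδ'
  have hδ'0 : 0 < δ' := lt_min hδ (by linarith)
  have c1 := concentration hp (fun _ : Unit => fun a => Real.log (p a) + shannonEntropy p)
    (fun _ => log_centered hp) hδ'0 hδ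
  have c2 := concentration hq (fun k : Option α => fun b =>
      k.elim (Real.log (q b) + shannonEntropy q) (fun a => ind a b - q a))
    (fun k => by
      cases k with
      | none => exact log_centered hq
      | some a =>
        simp only [Option.elim, mul_sub, Finset.sum_sub_distrib, ind_sum, ← Finset.sum_mul, hq.2]
        ring) hδ'0 (show (0:ℝ) < 1 / 2 by norm_num)
  have c3 : ∀ᶠ n : ℕ in Filter.atTop, 2 / γ ≤ n :=
    (tendsto_natCast_atTop_atTop (R := ℝ)).eventually_ge_atTop _
  obtain ⟨n, h1, h2, h3, hn⟩ :=
    (c1.and (c2.and (c3.and (Filter.eventually_gt_atTop 0)))).exists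
  have hn' : (0:ℝ) < n := by exact_mod_cast hn
  set A := Finset.univ.filter (fun x : Fin n → α => ∀ _ : Unit,
    |∑ i, (Real.log (p (x i)) + shannonEntropy p)| ≤ n * δ') with hA
  set T := Finset.univ.filter (fun x : Fin n → α => ∀ k : Option α,
    |∑ i, k.elim (Real.log (q (x i)) + shannonEntropy q) (fun a => ind a (x i) - q a)| ≤ n * δ')
    with hT
  have hAc : ∑ x ∈ Aᶜ, tpow p n x ≤ δ := by
    rw [hA, Finset.compl_filter]; exact h1
  have hTc : ∑ x ∈ Tᶜ, tpow q n x ≤ 1 / 2 := by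
    rw [hT, Finset.compl_filter]; exact h2
  have hTs : 1 / 2 ≤ ∑ x ∈ T, tpow q n x := by
    have := (tpow_pos hq n).2
    rw [← Finset.sum_add_sum_compl T] at this
    linarith
  have hAs : ∑ x ∈ A, tpow p n x ≤ 1 := by
    rw [← (tpow_pos hp n).2]
    exact Finset.sum_le_sum_of_subset_of_nonneg (Finset.subset_univ _)
      fun x _ _ => ((tpow_pos hp n).1 x).le
  have hAcard : (A.card : ℝ) * Real.exp (-(n * δ') - n * shannonEntropy p) ≤ 1 := by
    refine le_trans ?_ hAs
    rw [← nsmul_eq_mul]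
    refine Finset.card_nsmul_le_sum _ _ _ fun x hx => ?_
    rw [tpow_eq_exp hp]
    have := (abs_le.1 ((Finset.mem_filter.1 hx).2 ())).1
    gcongr
  have hTcard : 1 / 2 ≤ (T.card : ℝ) * Real.exp (n * δ' - n * shannonEntropy q) := by
    refine le_trans hTs ?_
    rw [← nsmul_eq_mul]
    refine Finset.sum_le_card_nsmul _ _ _ fun x hx => ?_
    rw [tpow_eq_exp hq]
    have := (abs_le.1 ((Finset.mem_filter.1 hx).2 none)).2
    simp only [Option.elim] at this
    gcongr
  have hcard : A.card ≤ T.card := by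
    have hg : δ' ≤ γ / 4 := min_le_right _ _
    have e1 : (2:ℝ) ≤ Real.exp (n * γ / 2) := by
      rw [div_le_iff₀ hγ0] at h3
      have := Real.add_one_le_exp (n * γ / 2)
      linarith
    have e2 : Real.exp (n * γ / 2) * Real.exp (n * δ' - n * shannonEntropy q) ≤
        Real.exp (-(n * δ') - n * shannonEntropy p) := by
      rw [← Real.exp_add]
      apply Real.exp_le_exp.2
      have : (n:ℝ) * δ' ≤ n * (γ / 4) := by gcongr
      have h5 : (n:ℝ) * γ = n * shannonEntropy q - n * shannonEntropy p := by rw [hγ]; ring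
      linarith
    set E := Real.exp (n * δ' - n * shannonEntropy q) with hE
    have hE0 : 0 < E := Real.exp_pos _
    have hA0 : (0:ℝ) ≤ A.card := by positivity
    have h6 : (A.card : ℝ) * (2 * E) ≤ 1 := by
      refine le_trans ?_ hAcard
      gcongr
      exact le_trans (by gcongr) e2
    have h7 : (A.card : ℝ) * E ≤ T.card * E := by linarith
    exact_mod_cast le_of_mul_le_mul_right h7 hE0
  obtain ⟨π, hπ⟩ := exists_perm A T hcard
  refine ⟨n, hn, π, A, hAc, fun x hx a => ?_⟩
  have := (Finset.mem_filter.1 (hπ x hx)).2 (some a)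
  simp only [Option.elim] at this
  refine this.trans ?_
  gcongr
  exact min_le_left _ _

lemma approx_le {S : ∀ n : ℕ, (Fin n → ℝ) → ℝ} (hsym : SymmetricS S) (hadd : AdditiveS S)
    (hsub : SubadditiveS S) {α : Type} [Fintype α] {p q : α → ℝ} (hp : IsPosProbDist p)
    (hq : IsPosProbDist q) (hH : shannonEntropy p < shannonEntropy q) {δ : ℝ} (hδ : 0 < δ) :
    ∃ r : α → ℝ, IsPosProbDist r ∧ (∀ a, |r a - q a| ≤ 2 * δ) ∧ SF S α p ≤ SF S α r := by
  classical
  obtain ⟨n, hn, π, A, hA, hπ⟩ := exists_good_perm hp hq hH hδ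
  have hn' : (0:ℝ) < n := by exact_mod_cast hn
  have : NeZero n := ⟨hn.ne'⟩
  have hP := tpow_pos hp n
  let sh : Fin n → Equiv.Perm (Fin n → α) := fun k => (Equiv.addRight k).arrowCongr (Equiv.refl α)
  set σ : Fin n → Equiv.Perm (Fin n → α) := fun k => (sh k).trans π.symm with hσ
  have hmix := SF_mix hsym hadd hsub hP σ
  set Q : (Fin n → α) → ℝ := fun x => ∑ k, tpow p n (σ k x) * (1 / (Fintype.card (Fin n) : ℝ))
    with hQ
  have hQp : IsPosProbDist Q := by
    constructor
    · intro x
      exact Finset.sum_pos (fun k _ => mul_pos (hP.1 _) (by simpa using hn)) Finset.univ_nonempty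
    · rw [hQ, Finset.sum_comm]
      simp only [← Finset.sum_mul]
      have : ∀ k, ∑ x, tpow p n (σ k x) = 1 := fun k => by
        rw [Equiv.sum_comp (σ k) (tpow p n), hP.2]
      simp [this, hn'.ne']
  set r : α → ℝ := fun a => ∑ x, tpow p n x * ((∑ i, ind a (π x i)) / n) with hr
  have hmarg : ∀ i, marg Q i = r := by
    intro i
    ext a
    simp only [marg, hQ, hr, Finset.sum_mul]
    rw [Finset.sum_comm]
    have : ∀ k, ∑ x, tpow p n (σ k x) * (1 / (Fintype.card (Fin n) : ℝ)) * ind a (x i) =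
        ∑ x, tpow p n x * (1 / n) * ind a (π x (i + k)) := by
      intro k
      rw [← Equiv.sum_comp (σ k) (fun x => tpow p n x * (1 / n) * ind a (π x (i + k)))]
      refine Finset.sum_congr rfl fun x _ => ?_
      simp [hσ, sh, Equiv.arrowCongr]
    simp only [this]
    rw [Finset.sum_comm]
    refine Finset.sum_congr rfl fun x _ => ?_
    have h8 : ∑ k, ind a (π x (i + k)) = ∑ j, ind a (π x j) :=
      Equiv.sum_comp (Equiv.addLeft i) (fun j => ind a (π x j))
    rw [← Finset.mul_sum, h8]
    ring
  have hsum := SF_marg hsym hadd hsub n Q hQp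
  simp only [hmarg, Finset.sum_const, Finset.card_univ, Fintype.card_fin, nsmul_eq_mul] at hsum
  rw [SF_tpow hsym hadd hp] at hmix
  refine ⟨r, ?_, ?_, le_of_mul_le_mul_left (hmix.trans hsum) hn'⟩
  · constructor
    · intro a
      let x0 : Fin n → α := fun _ => a
      refine Finset.sum_pos' (fun x _ => mul_nonneg (hP.1 x).le
        (div_nonneg (Finset.sum_nonneg fun i _ => ind_nonneg _ _) hn'.le))
        ⟨π.symm x0, Finset.mem_univ _, mul_pos (hP.1 _) ?_⟩
      simp [x0, ind]
    · simp only [hr]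
      rw [Finset.sum_comm]
      have : ∀ x : Fin n → α, ∑ a, tpow p n x * ((∑ i, ind a (π x i)) / n) = tpow p n x := by
        intro x
        rw [← Finset.mul_sum, ← Finset.sum_div, Finset.sum_comm]
        simp [ind_sum', hn'.ne']
      simp only [this, hP.2]
  · intro a
    have hqa : q a ≤ 1 := by
      rw [← hq.2]; exact Finset.single_le_sum (fun i _ => (hq.1 i).le) (Finset.mem_univ a)
    have e : r a - q a = ∑ x, tpow p n x * ((∑ i, (ind a (π x i) - q a)) / n) := by
      have : q a = ∑ x, tpow p n x * q a := by rw [← Finset.sum_mul, hP.2, one_mul]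
      rw [this, hr, ← Finset.sum_sub_distrib, ← this]
      refine Finset.sum_congr rfl fun x _ => ?_
      rw [Finset.sum_sub_distrib]
      simp only [Finset.sum_const, Finset.card_univ, Fintype.card_fin, nsmul_eq_mul]
      field_simp
    rw [e]
    refine (Finset.abs_sum_le_sum_abs _ _).trans ?_
    rw [← Finset.sum_add_sum_compl A]
    have b1 : ∑ x ∈ A, |tpow p n x * ((∑ i, (ind a (π x i) - q a)) / n)| ≤ δ := by
      calc _ ≤ ∑ x ∈ A, tpow p n x * δ := by
            refine Finset.sum_le_sum fun x hx => ?_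
            rw [abs_mul, abs_of_pos (hP.1 x), abs_div, abs_of_pos hn']
            refine mul_le_mul_of_nonneg_left ?_ (hP.1 x).le
            rw [div_le_iff₀ hn', mul_comm]
            exact hπ x hx a
        _ ≤ ∑ x, tpow p n x * δ := Finset.sum_le_sum_of_subset_of_nonneg (Finset.subset_univ _)
            fun x _ _ => mul_nonneg (hP.1 x).le hδ.le
        _ = δ := by rw [← Finset.sum_mul, hP.2, one_mul]
    have b2 : ∑ x ∈ Aᶜ, |tpow p n x * ((∑ i, (ind a (π x i) - q a)) / n)| ≤ δ := by
      refine le_trans (Finset.sum_le_sum fun x hx => ?_) hA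
      rw [abs_mul, abs_of_pos (hP.1 x), abs_div, abs_of_pos hn']
      refine mul_le_of_le_one_right (hP.1 x).le ?_
      rw [div_le_one hn']
      refine (Finset.abs_sum_le_sum_abs _ _).trans ?_
      calc _ ≤ ∑ i : Fin n, (1:ℝ) := Finset.sum_le_sum fun i _ => by
            rw [abs_le]
            have := ind_nonneg a (π x i)
            have := ind_le_one a (π x i)
            have := hq.1 a
            constructor <;> linarith
        _ = n := by simp
    linarith

lemma SF_le_of_lt {S : ∀ n : ℕ, (Fin n → ℝ) → ℝ} (hcont : ContinuousS S) (hsym : SymmetricS S)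
    (hadd : AdditiveS S) (hsub : SubadditiveS S) {α : Type} [Fintype α] {p q : α → ℝ}
    (hp : IsPosProbDist p) (hq : IsPosProbDist q) (hH : shannonEntropy p < shannonEntropy q) :
    SF S α p ≤ SF S α q := by
  by_contra! hlt
  set e := (Fintype.equivFin α).symm
  have hc := hcont _ _ (hq.comp_equiv e)
  have hev := hc.eventually (gt_mem_nhds (show S (Fintype.card α) (q ∘ e) < SF S α p from hlt))
  rw [eventually_nhdsWithin_iff, Metric.eventually_nhds_iff] at hev
  obtain ⟨ε, hε, h⟩ := hev
  obtain ⟨r, hr, hrq, hle⟩ := approx_le hsym hadd hsub hp hq hH (show 0 < ε / 4 by linarith)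
  have := h (y := r ∘ e) (by
    rw [dist_pi_lt_iff hε]
    intro i
    rw [Real.dist_eq]
    have := hrq (e i)
    simp only [Function.comp]
    linarith) (hr.comp_equiv e)
  exact absurd hle (not_le.2 this)

/-- Shannon entropy as a family. -/
noncomputable def SH : ∀ n : ℕ, (Fin n → ℝ) → ℝ := fun _ p => shannonEntropy p

lemma shannon_comp {ι κ : Type} [Fintype ι] [Fintype κ] (e : ι ≃ κ) (p : κ → ℝ) :
    shannonEntropy (p ∘ e) = shannonEntropy p := by
  unfold shannonEntropy
  rw [← Equiv.sum_comp e (fun i => p i * Real.log (p i))]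
  rfl

lemma shannon_kron {ι κ : Type} [Fintype ι] [Fintype κ] {p : ι → ℝ} {q : κ → ℝ}
    (hp : IsPosProbDist p) (hq : IsPosProbDist q) :
    shannonEntropy (kron p q) = shannonEntropy p + shannonEntropy q := by
  unfold shannonEntropy
  rw [← neg_add, neg_inj, Fintype.sum_prod_type]
  have : ∀ i j, kron p q (i, j) * Real.log (kron p q (i, j)) =
      p i * Real.log (p i) * q j + p i * (q j * Real.log (q j)) := by
    intro i j
    simp only [kron]
    rw [Real.log_mul (hp.1 i).ne' (hq.1 j).ne']
    ring
  simp only [this, Finset.sum_add_distrib, ← Finset.mul_sum, hq.2, mul_one, ← Finset.sum_mul, hp.2,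
    one_mul]

lemma SH_sym : SymmetricS SH := fun _ p _ σ => shannon_comp σ p

lemma SH_add : AdditiveS SH := fun m n p q hp hq => by
  refine Eq.trans ?_ (shannon_kron hp hq)
  exact shannon_comp finProdFinEquiv.symm (kron p q)

lemma SF_SH {ι : Type} [Fintype ι] (p : ι → ℝ) : SF SH ι p = shannonEntropy p :=
  shannon_comp (Fintype.equivFin ι).symm p

lemma shannon_tpow {α : Type} [Fintype α] {p : α → ℝ} (hp : IsPosProbDist p) (n : ℕ) :
    shannonEntropy (tpow p n) = n * shannonEntropy p := by
  rw [← SF_SH, ← SF_SH, SF_tpow SH_sym SH_add hp]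

lemma SF_le_of_le {S : ∀ n : ℕ, (Fin n → ℝ) → ℝ} (hcont : ContinuousS S) (hsym : SymmetricS S)
    (hadd : AdditiveS S) (hsub : SubadditiveS S) {α : Type} [Fintype α] {p q : α → ℝ}
    (hp : IsPosProbDist p) (hq : IsPosProbDist q) (hH : shannonEntropy p ≤ shannonEntropy q) :
    SF S α p ≤ SF S α q := by
  let s : Fin 2 → ℝ := ![1/3, 2/3]
  let t : Fin 2 → ℝ := ![1/2, 1/2]
  have hs : IsPosProbDist s := ⟨fun i => by fin_cases i <;> norm_num [s], by
    norm_num [s, Fin.sum_univ_two]⟩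
  have ht : IsPosProbDist t := ⟨fun i => by fin_cases i <;> norm_num [t], by
    norm_num [t, Fin.sum_univ_two]⟩
  have hst : shannonEntropy s < shannonEntropy t := by
    have l1 : Real.log (1/3) = - Real.log 3 := by rw [one_div, Real.log_inv]
    have l2 : Real.log (2/3) = Real.log 2 - Real.log 3 := Real.log_div (by norm_num) (by norm_num)
    have l3 : Real.log (1/2) = - Real.log 2 := by rw [one_div, Real.log_inv]
    have l4 : 3 * Real.log 3 < 5 * Real.log 2 := by
      have : Real.log (3 ^ 3) < Real.log (2 ^ 5) := Real.log_lt_log (by norm_num) (by norm_num)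
      rw [Real.log_pow, Real.log_pow] at this
      exact_mod_cast this
    simp only [shannonEntropy, Fin.sum_univ_two, s, t, Matrix.cons_val_zero, Matrix.cons_val_one,
      l1, l2, l3]
    linarith
  have key : ∀ k : ℕ, k * (SF S α p - SF S α q) ≤ SF S _ t - SF S _ s := by
    intro k
    have h := SF_le_of_lt hcont hsym hadd hsub ((tpow_pos hp k).kron' hs)
      ((tpow_pos hq k).kron' ht) (by
        rw [shannon_kron (tpow_pos hp k) hs, shannon_kron (tpow_pos hq k) ht, shannon_tpow hp,
          shannon_tpow hq]
        have : (k:ℝ) * shannonEntropy p ≤ k * shannonEntropy q := by gcongr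
        linarith)
    rw [SF_kron hsym hadd (tpow_pos hp k) hs, SF_kron hsym hadd (tpow_pos hq k) ht,
      SF_tpow hsym hadd hp, SF_tpow hsym hadd hq] at h
    linarith
  by_contra! hlt
  have hd : 0 < SF S α p - SF S α q := sub_pos.2 hlt
  obtain ⟨k, hk⟩ := exists_nat_gt ((SF S _ t - SF S _ s) / (SF S α p - SF S α q))
  rw [div_lt_iff₀ hd] at hk
  exact absurd (key k) (not_le.2 hk)

lemma shannon_unif {n : ℕ} (hn : 0 < n) :
    shannonEntropy (fun _ : Fin n => 1 / (n : ℝ)) = Real.log n := by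
  have hn' : (n:ℝ) ≠ 0 := by exact_mod_cast hn.ne'
  simp [shannonEntropy, hn']

/-- For continuous, symmetric, additive and subadditive `S`, with
`I(p) = log m - H(p)` and `J(p) = S(η_m) - S(p)`: `I(p) ≥ I(q)` implies `J(p) ≥ J(q)`. -/
theorem negentropy_monotone (S : ∀ n : ℕ, (Fin n → ℝ) → ℝ)
    (hcont : ContinuousS S) (hsym : SymmetricS S)
    (hadd : AdditiveS S) (hsub : SubadditiveS S)
    {m n : ℕ} (p : Fin m → ℝ) (q : Fin n → ℝ)
    (hp : IsPosProbDist p) (hq : IsPosProbDist q)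
    (hI : Real.log n - shannonEntropy q ≤ Real.log m - shannonEntropy p) :
    S n (fun _ => 1 / (n : ℝ)) - S n q ≤ S m (fun _ => 1 / (m : ℝ)) - S m p := by

  have hm : 0 < m := Fin.pos_iff_nonempty.2 hp.nonempty'
  have hn : 0 < n := Fin.pos_iff_nonempty.2 hq.nonempty'
  have : Nonempty (Fin m) := hp.nonempty'
  have : Nonempty (Fin n) := hq.nonempty'
  have um : IsPosProbDist (fun _ : Fin m => 1 / (m : ℝ)) := by
    simpa using unif_pos (κ := Fin m)
  have un : IsPosProbDist (fun _ : Fin n => 1 / (n : ℝ)) := by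
    simpa using unif_pos (κ := Fin n)
  have h := SF_le_of_le hcont hsym hadd hsub (hp.kron' un) (um.kron' hq) (by
    rw [shannon_kron hp un, shannon_kron um hq, shannon_unif hm, shannon_unif hn]
    linarith)
  have hSF : ∀ {k : ℕ} {f : Fin k → ℝ}, IsPosProbDist f → SF S (Fin k) f = S k f :=
    fun hf => SF_eq hsym (Equiv.refl _) hf
  rw [SF_kron hsym hadd hp un, SF_kron hsym hadd um hq, hSF hp, hSF un, hSF um, hSF hq] at h
  linarith
end
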